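/- arXiv:0909.3921 — 2 statements merged into one kernel-verified Lean document; each statement's English description precedes it below -/
import Mathlib

section
/- Suppose (A1)-(A3) hold, all coordinates of the mean vector M are nonnegative, and set Λ = Λ(M). Then for every strictly positive harmonic function f of the induced Markov chain X_M, the function h(x) = f(x^Λ) − E_x(f(S^Λ(τ)); τ < τ_Λ) is finite, strictly positive, and harmonic for the killed Markov chain (Z(t)). -/
open Filter Topology

attribute [local instance] Classical.propDecidable

noncomputable section

variable {V : Type*} [AddCommGroup V]

/-- `n`-step transition kernel of the random walk with step distribution `μ`,
killed upon leaving the set `A` : `kern μ A n x y = P_x(S n = y, τ_A > n)`,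
where `τ_A` is the first exit time from `A`. -/
def kern (μ : V → ℝ) (A : Set V) : ℕ → V → V → ℝ
  | 0 => fun x y => if x = y ∧ x ∈ A then 1 else 0
  | n + 1 => fun x y => ∑' z : V, (if x ∈ A then μ (z - x) else 0) * kern μ A n z y

/-- Green function of the walk killed outside `A`. -/
def green (μ : V → ℝ) (A : Set V) (x y : V) : ℝ :=
  ∑' n : ℕ, kern μ A n x y

/-- `E_x [ g(S τ) ; S τ ∈ B, τ < ∞ ]`, where `τ` is the first exit time from `A`. -/
def exitExp (μ : V → ℝ) (A B : Set V) (g : V → ℝ) (x : V) : ℝ :=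
  ∑' n : ℕ, ∑' z : V, kern μ A n x z *
    ∑' y : V, (if y ∉ A ∧ y ∈ B then μ (y - z) else 0) * g y

/-- `ℝ≥0∞`-valued version of `exitExp`. -/
def exitExpE (μ : V → ℝ) (A B : Set V) (g : V → ℝ) (x : V) : ENNReal :=
  ∑' n : ℕ, ∑' z : V, ENNReal.ofReal (kern μ A n x z) *
    ∑' y : V, ENNReal.ofReal ((if y ∉ A ∧ y ∈ B then μ (y - z) else 0) * g y)

/-- `P_x(S t = y for some t ≥ 0)` for the walk killed outside `A`
(first passage decomposition). -/
def hitProb (μ : V → ℝ) (A : Set V) (x y : V) : ℝ :=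
  (if x = y ∧ x ∈ A then 1 else 0) +
    ∑' n : ℕ, ∑' z : V, kern μ (A \ {y}) n x z * (if y ∈ A then μ (y - z) else 0)

/-- `h` is (strictly speaking, satisfies the mean value property of a) harmonic
function on `A` for the walk with step distribution `μ` killed outside `A`. -/
def HarmOn (μ : V → ℝ) (A : Set V) (h : V → ℝ) : Prop :=
  ∀ x ∈ A, h x = ∑' y : V, if y ∈ A then μ (y - x) * h y else 0

/-- Irreducibility of the walk killed outside `A`. -/
def Irred (μ : V → ℝ) (A : Set V) : Prop :=
  ∀ x ∈ A, ∀ x' ∈ A, ∃ (k : ℕ) (c : ℕ → V), c 0 = x ∧ c k = x' ∧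
    (∀ j ≤ k, c j ∈ A) ∧ ∀ j < k, 0 < μ (c (j + 1) - c j)

/-- A sequence `xs` is fundamental for the walk killed outside `A` :
the Martin kernels `G(x, xs n)/G(x₀, xs n)` converge for every `x ∈ A`. -/
def Fundamental (μ : V → ℝ) (A : Set V) (x₀ : V) (xs : ℕ → V) : Prop :=
  ∀ x ∈ A, ∃ L : ℝ,
    Tendsto (fun n => green μ A x (xs n) / green μ A x₀ (xs n)) atTop (𝓝 L)

/-- ℓ¹-norm of an integer vector. -/
def znorm {ι : Type*} [Fintype ι] (x : ι → ℤ) : ℝ := ∑ i, |(x i : ℝ)|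

/-- ℓ¹-norm of a real vector. -/
def rnorm {ι : Type*} [Fintype ι] (q : ι → ℝ) : ℝ := ∑ i, |q i|

variable {d : ℕ}

/-- `ℤ^{Λ,d}_+ = {x ∈ ℤ^d : xⁱ > 0 for all i ∈ Λ}`. -/
def posDom (Λ : Set (Fin d)) : Set (Fin d → ℤ) := {x | ∀ i ∈ Λ, 0 < x i}

/-- `ℤ^d_+ = {x ∈ ℤ^d : xⁱ > 0 for all i}`. -/
def posAll : Set (Fin d → ℤ) := {x | ∀ i, 0 < x i}

/-- `a · z` for `a ∈ ℝ^d`, `z ∈ ℤ^d`. -/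
def dotZ (a : Fin d → ℝ) (z : Fin d → ℤ) : ℝ := ∑ i, a i * (z i : ℝ)

/-- `a · q` for `a, q ∈ ℝ^d`. -/
def dotR (a q : Fin d → ℝ) : ℝ := ∑ i, a i * q i

/-- jump generating function `φ(a) = Σ_z μ(z) exp(a·z)` (valued in `ℝ≥0∞`). -/
def phiE (μ : (Fin d → ℤ) → ℝ) (a : Fin d → ℝ) : ENNReal :=
  ∑' z : Fin d → ℤ, ENNReal.ofReal (μ z * Real.exp (dotZ a z))

/-- `D = {a ∈ ℝ^d : φ(a) ≤ 1}`. -/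
def Dset (μ : (Fin d → ℤ) → ℝ) : Set (Fin d → ℝ) := {a | phiE μ a ≤ 1}

/-- mean vector `M = Σ_z μ(z) z`. -/
def Mvec (μ : (Fin d → ℤ) → ℝ) : Fin d → ℝ := fun i => ∑' z : Fin d → ℤ, μ z * (z i : ℝ)

/-- `Λ(M) = {i : Mⁱ = 0}`. -/
def LambdaM (μ : (Fin d → ℤ) → ℝ) : Set (Fin d) := {i | Mvec μ i = 0}

/-- Assumption (A1) : irreducibility on every `ℤ^{Λ,d}_+`. -/
def A1 (μ : (Fin d → ℤ) → ℝ) : Prop := ∀ Λ : Set (Fin d), Irred μ (posDom Λ)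

/-- Assumption (A2) : `φ` is finite on a neighborhood of the set `D`. -/
def A2 (μ : (Fin d → ℤ) → ℝ) : Prop :=
  ∃ U : Set (Fin d → ℝ), IsOpen U ∧ Dset μ ⊆ U ∧ ∀ a ∈ U, phiE μ a ≠ ⊤

/-- Assumption (A3) : `M ≠ 0`. -/
def A3 (μ : (Fin d → ℤ) → ℝ) : Prop := Mvec μ ≠ 0

/-- projection `x ↦ x^Λ`. -/
def projL (Λ : Set (Fin d)) (x : Fin d → ℤ) : ↥Λ → ℤ := fun i => x (i : Fin d)

/-- jump distribution `μ_Λ(v) = Σ_{x : x^Λ = v} μ(x)` of the projected walk. -/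
def muL (μ : (Fin d → ℤ) → ℝ) (Λ : Set (Fin d)) (v : ↥Λ → ℤ) : ℝ :=
  ∑' x : Fin d → ℤ, if projL Λ x = v then μ x else 0

/-- `ℤ^Λ_+`. -/
def posL (Λ : Set (Fin d)) : Set (↥Λ → ℤ) := {u | ∀ i, 0 < u i}

end

section ExitExpectation

variable {V : Type*} [AddCommGroup V] {μ : V → ℝ}

lemma summable_jump (hsum : HasSum μ 1) (x : V) : Summable fun z => μ (z - x) :=
  (Equiv.subRight x).summable_iff.mpr hsum.summable

lemma tsum_jump (hsum : HasSum μ 1) (x : V) : ∑' z, μ (z - x) = 1 :=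
  ((Equiv.subRight x).tsum_eq μ).trans hsum.tsum_eq

lemma kern_mem_Icc (hnn : ∀ z, 0 ≤ μ z) (hsum : HasSum μ 1) (A : Set V) (n : ℕ) (x y : V) :
    kern μ A n x y ∈ Set.Icc (0 : ℝ) 1 := by
  induction n generalizing x with
  | zero => unfold kern; split_ifs <;> simp
  | succ n ih =>
    have h0 (z : V) : 0 ≤ if x ∈ A then μ (z - x) else 0 := by
      split_ifs; exacts [hnn _, le_rfl]
    have hle (z : V) : (if x ∈ A then μ (z - x) else 0) * kern μ A n z y ≤ μ (z - x) := by
      refine (mul_le_of_le_one_right (h0 z) (ih z).2).trans ?_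
      split_ifs; exacts [le_rfl, hnn _]
    have hnn' (z : V) : 0 ≤ (if x ∈ A then μ (z - x) else 0) * kern μ A n z y :=
      mul_nonneg (h0 z) (ih z).1
    refine ⟨tsum_nonneg hnn', ?_⟩
    rw [← tsum_jump hsum x]
    exact Summable.tsum_le_tsum hle (.of_nonneg_of_le hnn' hle (summable_jump hsum x))
      (summable_jump hsum x)

lemma ofReal_kern_succ (hnn : ∀ z, 0 ≤ μ z) (hsum : HasSum μ 1) {A : Set V} (n : ℕ) {x : V}
    (hx : x ∈ A) (y : V) :
    ENNReal.ofReal (kern μ A (n + 1) x y) =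
      ∑' z, ENNReal.ofReal (μ (z - x)) * ENNReal.ofReal (kern μ A n z y) := by
  have hk (z : V) := kern_mem_Icc hnn hsum A n z y
  have hnn' (z : V) : 0 ≤ μ (z - x) * kern μ A n z y := mul_nonneg (hnn _) (hk z).1
  simp only [kern, hx, if_true]
  rw [ENNReal.ofReal_tsum_of_nonneg hnn' (.of_nonneg_of_le hnn'
    (fun z => mul_le_of_le_one_right (hnn _) (hk z).2) (summable_jump hsum x))]
  exact tsum_congr fun z => ENNReal.ofReal_mul (hnn _)

/-- `E_x [ e(S n) ; τ_A > n ]` for the walk killed upon leaving `A`. -/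
noncomputable def killedExp (μ : V → ℝ) (A : Set V) (e : V → ENNReal) (n : ℕ) (x : V) : ENNReal :=
  ∑' z, ENNReal.ofReal (kern μ A n x z) * e z

lemma killedExp_of_notMem {A : Set V} (e : V → ENNReal) (n : ℕ) {x : V} (hx : x ∉ A) :
    killedExp μ A e n x = 0 := by
  cases n <;> simp [killedExp, kern, hx]

lemma killedExp_zero {A : Set V} (e : V → ENNReal) {x : V} (hx : x ∈ A) :
    killedExp μ A e 0 x = e x := by
  unfold killedExp
  rw [tsum_eq_single x fun z hz => by simp [kern, hz.symm]]
  simp [kern, hx]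

lemma killedExp_succ (hnn : ∀ z, 0 ≤ μ z) (hsum : HasSum μ 1) {A : Set V} (e : V → ENNReal)
    (n : ℕ) {x : V} (hx : x ∈ A) :
    killedExp μ A e (n + 1) x = ∑' z, ENNReal.ofReal (μ (z - x)) * killedExp μ A e n z := by
  simp only [killedExp, ofReal_kern_succ hnn hsum n hx, ← ENNReal.tsum_mul_right,
    ← ENNReal.tsum_mul_left]
  rw [ENNReal.tsum_comm]
  simp only [mul_assoc]

/-- Expected reward when the exit from `A` to `B` happens at the next step. -/
noncomputable def exitReward (μ : V → ℝ) (A B : Set V) (g : V → ℝ) (x : V) : ENNReal :=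
  ∑' y, ENNReal.ofReal ((if y ∉ A ∧ y ∈ B then μ (y - x) else 0) * g y)

lemma exitExpE_eq_tsum_killedExp (A B : Set V) (g : V → ℝ) (x : V) :
    exitExpE μ A B g x = ∑' n, killedExp μ A (exitReward μ A B g) n x := rfl

lemma exitExpE_of_notMem {A : Set V} (B : Set V) (g : V → ℝ) {x : V} (hx : x ∉ A) :
    exitExpE μ A B g x = 0 := by
  simp [exitExpE_eq_tsum_killedExp, killedExp_of_notMem _ _ hx]

lemma exitExpE_eq_add (hnn : ∀ z, 0 ≤ μ z) (hsum : HasSum μ 1) {A : Set V} (B : Set V)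
    (g : V → ℝ) {x : V} (hx : x ∈ A) :
    exitExpE μ A B g x =
      exitReward μ A B g x + ∑' z, ENNReal.ofReal (μ (z - x)) * exitExpE μ A B g z := by
  rw [exitExpE_eq_tsum_killedExp, tsum_eq_zero_add' ENNReal.summable, killedExp_zero _ hx]
  simp only [killedExp_succ hnn hsum _ _ hx, exitExpE_eq_tsum_killedExp, ← ENNReal.tsum_mul_left]
  rw [ENNReal.tsum_comm]

/-- A supersolution dominating the exit reward dominates the exit expectation. -/
lemma exitExpE_le (hnn : ∀ z, 0 ≤ μ z) (hsum : HasSum μ 1) {A B : Set V} {g : V → ℝ}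
    {G : V → ENNReal}
    (hG : ∀ x ∈ A, exitReward μ A B g x +
      (∑' z, if z ∈ A then ENNReal.ofReal (μ (z - x)) * G z else 0) ≤ G x)
    {x : V} (hx : x ∈ A) : exitExpE μ A B g x ≤ G x := by
  rw [exitExpE_eq_tsum_killedExp, ENNReal.tsum_eq_iSup_nat]
  refine iSup_le fun N => ?_
  induction N generalizing x with
  | zero => simp
  | succ N ih =>
    rw [Finset.sum_range_succ', killedExp_zero _ hx, add_comm]
    simp only [killedExp_succ hnn hsum _ _ hx]
    rw [← Summable.tsum_finsetSum fun _ _ => ENNReal.summable]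
    refine le_trans (add_le_add le_rfl (ENNReal.tsum_le_tsum fun z => ?_)) (hG x hx)
    rw [← Finset.mul_sum]
    split_ifs with hz
    · gcongr; exact ih hz
    · simp [killedExp_of_notMem _ _ hz]

end ExitExpectation

section Subadditive

lemma map_nsmul_le_of_subadditive {G : Type*} [AddCommGroup G] {p : G → ℝ}
    (hp : ∀ v w, p (v + w) ≤ p v + p w) (v : G) {n : ℕ} (hn : 0 < n) : p (n • v) ≤ n * p v := by
  induction n, hn using Nat.le_induction with
  | base => simp
  | succ n _ ih =>
    rw [succ_nsmul]
    refine (hp _ _).trans ?_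
    push_cast
    linarith

/-- One step of the Hahn–Banach extension, over `ℤ`, with the largest admissible slope. -/
lemma exists_slope_of_subadditive {G : Type*} [AddCommGroup G] {p : G → ℝ}
    (hp : ∀ v w, p (v + w) ≤ p v + p w) (H : AddSubgroup G) (a : G →+ ℝ)
    (ha : ∀ h ∈ H, a h ≤ p h) (w : G) :
    ∃ c : ℝ, (∀ h ∈ H, ∀ n : ℤ, a h + n * c ≤ p (h + n • w)) ∧
      ∀ κ : ℝ, (∀ h ∈ H, ∀ n : ℕ, 0 < n → a h + n * κ ≤ p (h + n • w)) → κ ≤ c := by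
  set S : Set ℝ := {c | ∃ h ∈ H, ∃ n : ℕ, 0 < n ∧ c = (p (h + n • w) - a h) / n} with hS
  have hne : S.Nonempty := ⟨_, 0, H.zero_mem, 1, one_pos, rfl⟩
  have hlow : ∀ h ∈ H, ∀ m : ℕ, 0 < m → (a h - p (h - m • w)) / m ∈ lowerBounds S := by
    rintro h hh m hm _ ⟨h', hh', n, hn, rfl⟩
    have hm' : (0 : ℝ) < m := by exact_mod_cast hm
    have hn' : (0 : ℝ) < n := by exact_mod_cast hn
    rw [div_le_div_iff₀ hm' hn']
    have h1 := ha _ (H.add_mem (H.nsmul_mem hh n) (H.nsmul_mem hh' m))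
    have h2 : n • h + m • h' = n • (h - m • w) + m • (h' + n • w) := by
      rw [smul_sub, smul_add, smul_comm n m w]; abel
    have h3 := hp (n • (h - m • w)) (m • (h' + n • w))
    have h4 := map_nsmul_le_of_subadditive hp (h - m • w) hn
    have h5 := map_nsmul_le_of_subadditive hp (h' + n • w) hm
    rw [← h2] at h3
    simp only [map_add, map_nsmul, nsmul_eq_mul] at h1
    linarith
  have hbdd : BddBelow S := ⟨_, hlow 0 H.zero_mem 1 one_pos⟩
  refine ⟨sInf S, fun h hh n => ?_, fun κ hκ => le_csInf hne ?_⟩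
  · rcases lt_trichotomy n 0 with hn | rfl | hn
    · obtain ⟨m, rfl⟩ : ∃ m : ℕ, n = -m := ⟨n.natAbs, by omega⟩
      have hm : 0 < m := by omega
      have hm' : (0 : ℝ) < m := by exact_mod_cast hm
      have := le_csInf hne (hlow h hh m hm)
      rw [div_le_iff₀ hm'] at this
      rw [neg_smul, natCast_zsmul, ← sub_eq_add_neg]
      push_cast
      linarith
    · simpa using ha h hh
    · obtain ⟨m, rfl⟩ : ∃ m : ℕ, n = m := ⟨n.natAbs, by omega⟩
      have hm : 0 < m := by omega
      have hm' : (0 : ℝ) < m := by exact_mod_cast hm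
      have := csInf_le hbdd ⟨h, hh, m, hm, rfl⟩
      rw [le_div_iff₀ hm'] at this
      rw [natCast_zsmul]
      push_cast
      linarith
  · rintro _ ⟨h, hh, n, hn, rfl⟩
    rw [le_div_iff₀ (by exact_mod_cast hn)]
    linarith [hκ h hh n hn]

variable {d : ℕ}

lemma dotZ_add (a : Fin d → ℝ) (v w : Fin d → ℤ) : dotZ a (v + w) = dotZ a v + dotZ a w := by
  simp [dotZ, mul_add, Finset.sum_add_distrib]

lemma dotZ_smul (t : ℝ) (a : Fin d → ℝ) (v : Fin d → ℤ) : dotZ (t • a) v = t * dotZ a v := by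
  simp [dotZ, Finset.mul_sum, mul_assoc]

lemma dotZ_single (a : Fin d → ℝ) (i : Fin d) (n : ℤ) : dotZ a (Pi.single i n) = a i * n := by
  unfold dotZ
  rw [Finset.sum_eq_single i (fun k _ hk => by simp [hk]) (by simp)]
  simp

lemma dotZ_update (a : Fin d → ℝ) (i : Fin d) (c : ℝ) (v : Fin d → ℤ) :
    dotZ (Function.update a i c) v = dotZ a (Function.update v i 0) + v i * c := by
  unfold dotZ
  rw [← Finset.add_sum_erase _ _ (Finset.mem_univ i),
    ← Finset.add_sum_erase _ (fun k => a k * _) (Finset.mem_univ i)]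
  rw [Finset.sum_congr rfl fun k hk => by
    rw [Function.update_of_ne (Finset.ne_of_mem_erase hk)]]
  rw [Finset.sum_congr (g := fun k => a k * (Function.update v i 0 k : ℤ)) rfl fun k hk => by
    rw [Function.update_of_ne (Finset.ne_of_mem_erase hk)]]
  simp [mul_comm, add_comm]

/-- `dotZ a` as an additive homomorphism. -/
noncomputable def dotZHom (a : Fin d → ℝ) : (Fin d → ℤ) →+ ℝ :=
  AddMonoidHom.mk' (dotZ a) (dotZ_add a)

/-- The integer vectors supported in `s`. -/
def supportedIn (s : Finset (Fin d)) : AddSubgroup (Fin d → ℤ) where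
  carrier := {v | ∀ i ∉ s, v i = 0}
  zero_mem' := fun _ _ => rfl
  add_mem' := fun hv hw i hi => by simp [hv i hi, hw i hi]
  neg_mem' := fun hv i hi => by simp [hv i hi]

lemma exists_update_dotZ_le {p : (Fin d → ℤ) → ℝ} (hp : ∀ v w, p (v + w) ≤ p v + p w)
    (s : Finset (Fin d)) (a : Fin d → ℝ) (ha : ∀ v ∈ supportedIn s, dotZ a v ≤ p v) (i : Fin d) :
    ∃ c : ℝ, (∀ v ∈ supportedIn (insert i s), dotZ (Function.update a i c) v ≤ p v) ∧
      ∀ κ : ℝ, (∀ v ∈ supportedIn s, ∀ n : ℕ, 0 < n →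
        dotZ a v + n * κ ≤ p (v + n • Pi.single i 1)) → κ ≤ c := by
  obtain ⟨c, hc, hκ⟩ := exists_slope_of_subadditive hp (supportedIn s) (dotZHom a) ha
    (Pi.single i 1)
  refine ⟨c, fun v hv => ?_, hκ⟩
  have hmem : Function.update v i 0 ∈ supportedIn s := fun k hk => by
    by_cases hki : k = i
    · subst hki; simp
    · rw [Function.update_of_ne hki]
      exact hv k (by simp [hk, hki])
  have hv' : Function.update v i 0 + v i • Pi.single i 1 = v := by
    ext k
    by_cases hki : k = i
    · subst hki; simp
    · simp [hki]
  have := hc _ hmem (v i)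
  rw [hv'] at this
  rw [dotZ_update]
  exact this

/-- A subadditive function on `ℤ^d` growing at least at rate `κ` along the `j`-th axis dominates
a linear form of slope at least `κ` along this axis. -/
lemma exists_dotZ_le_of_subadditive {p : (Fin d → ℤ) → ℝ} (hp : ∀ v w, p (v + w) ≤ p v + p w)
    {j : Fin d} {κ : ℝ} (hκ : ∀ n : ℕ, 0 < n → n * κ ≤ p (n • Pi.single j 1)) :
    ∃ a : Fin d → ℝ, κ ≤ a j ∧ ∀ v, dotZ a v ≤ p v := by
  have key (s : Finset (Fin d)) :
      ∃ a : Fin d → ℝ, κ ≤ a j ∧ ∀ v ∈ supportedIn (insert j s), dotZ a v ≤ p v := by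
    induction s using Finset.induction_on with
    | empty =>
      have hzero {v : Fin d → ℤ} (hv : v ∈ supportedIn ∅) : v = 0 :=
        funext fun i => hv i (by simp)
      obtain ⟨c, hc, hc'⟩ := exists_update_dotZ_le hp ∅ 0 (fun v hv => by
        rw [hzero hv]
        have := hp 0 0
        rw [add_zero] at this
        simp only [dotZ, Pi.zero_apply, zero_mul, Finset.sum_const_zero]
        linarith) j
      refine ⟨_, ?_, hc⟩
      rw [Function.update_self]
      refine hc' κ fun v hv n hn => ?_
      rw [hzero hv]
      simpa [dotZ] using hκ n hn
    | insert i s _ ih =>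
      obtain ⟨a, haj, ha⟩ := ih
      by_cases hi : i ∈ insert j s
      · refine ⟨a, haj, ?_⟩
        rwa [Finset.insert_comm, Finset.insert_eq_of_mem hi]
      · obtain ⟨c, hc, -⟩ := exists_update_dotZ_le hp _ a ha i
        refine ⟨Function.update a i c, ?_, by rwa [Finset.insert_comm]⟩
        rwa [Function.update_of_ne]
        rintro rfl
        simp at hi
  obtain ⟨a, haj, ha⟩ := key Finset.univ
  exact ⟨a, haj, fun v => ha v fun i hi => by simp at hi⟩

end Subadditive

section GrowthRatio

lemma le_one_of_pow_le_polynomial {b K : ℝ} (k : ℕ) (h : ∀ n : ℕ, b ^ n ≤ K * ((n : ℝ) + 1) ^ k) :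
    b ≤ 1 := by
  by_contra! hb
  have hb0 : 0 < b := one_pos.trans hb
  have hK : 0 < K := by simpa using one_pos.trans_le (by simpa using h 0 : (1 : ℝ) ≤ K)
  have ht := (tendsto_pow_const_div_const_pow_of_one_lt k hb).comp (tendsto_add_atTop_nat 1)
  refine (ge_of_tendsto' ht fun n => ?_).not_gt (by positivity : 0 < 1 / (K * b))
  simp only [Function.comp_apply, Nat.cast_add, Nat.cast_one]
  rw [div_le_div_iff₀ (by positivity) (by positivity), pow_succ]
  nlinarith [h n]

variable {d : ℕ} {l : Filter (Fin d → ℤ)} {F : (Fin d → ℤ) → ℝ}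

/-- The largest `c` such that `c * F (x + v) ≤ F x` along `l`, asymptotically. -/
noncomputable def growthRatio (l : Filter (Fin d → ℤ)) (F : (Fin d → ℤ) → ℝ) (v : Fin d → ℤ) : ℝ :=
  sSup {c | ∀ᶠ x in l, c * F (x + v) ≤ F x}

lemma bddAbove_ratios [l.NeBot] (hl : ∀ v, Tendsto (· + v) l l) (hpos : ∀ᶠ x in l, 0 < F x)
    (hH : ∀ v, ∃ δ > 0, ∀ᶠ x in l, δ * F (x + v) ≤ F x) (v : Fin d → ℤ) :
    BddAbove {c | ∀ᶠ x in l, c * F (x + v) ≤ F x} := by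
  obtain ⟨δ, hδ, h⟩ := hH (-v)
  refine ⟨1 / δ, fun c hc => ?_⟩
  obtain ⟨x, hx, hx', hx''⟩ := (hc.and (((hl v).eventually h).and ((hl v).eventually hpos))).exists
  rw [add_neg_cancel_right] at hx'
  rw [le_div_iff₀ hδ]
  by_contra! hcon
  nlinarith

lemma le_growthRatio [l.NeBot] (hl : ∀ v, Tendsto (· + v) l l) (hpos : ∀ᶠ x in l, 0 < F x)
    (hH : ∀ v, ∃ δ > 0, ∀ᶠ x in l, δ * F (x + v) ≤ F x) {v : Fin d → ℤ} {c : ℝ}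
    (hc : ∀ᶠ x in l, c * F (x + v) ≤ F x) : c ≤ growthRatio l F v :=
  le_csSup (bddAbove_ratios hl hpos hH v) hc

lemma growthRatio_pos [l.NeBot] (hl : ∀ v, Tendsto (· + v) l l) (hpos : ∀ᶠ x in l, 0 < F x)
    (hH : ∀ v, ∃ δ > 0, ∀ᶠ x in l, δ * F (x + v) ≤ F x) (v : Fin d → ℤ) :
    0 < growthRatio l F v :=
  let ⟨_, hδ, h⟩ := hH v
  hδ.trans_le (le_growthRatio hl hpos hH h)

lemma eventually_mul_le_of_lt_growthRatio (hl : ∀ v, Tendsto (· + v) l l)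
    (hpos : ∀ᶠ x in l, 0 < F x) (hH : ∀ v, ∃ δ > 0, ∀ᶠ x in l, δ * F (x + v) ≤ F x)
    {v : Fin d → ℤ} {c : ℝ} (hc : c < growthRatio l F v) : ∀ᶠ x in l, c * F (x + v) ≤ F x := by
  obtain ⟨δ, -, h⟩ := hH v
  obtain ⟨c', hc', hlt⟩ := exists_lt_of_lt_csSup (s := {c | ∀ᶠ x in l, c * F (x + v) ≤ F x})
    ⟨δ, h⟩ hc
  filter_upwards [hc', (hl v).eventually hpos] with x hx hx'
  exact (mul_le_mul_of_nonneg_right hlt.le hx'.le).trans hx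

/-- The growth ratio inherits superharmonicity. -/
lemma sum_mul_growthRatio_le [l.NeBot] (hl : ∀ v, Tendsto (· + v) l l)
    (hpos : ∀ᶠ x in l, 0 < F x) (hH : ∀ v, ∃ δ > 0, ∀ᶠ x in l, δ * F (x + v) ≤ F x)
    {μ : (Fin d → ℤ) → ℝ} (hnn : ∀ z, 0 ≤ μ z) {Z : Finset (Fin d → ℤ)}
    (hZ : ∀ᶠ x in l, ∑ z ∈ Z, μ z * F (x + z) ≤ F x) (v : Fin d → ℤ) :
    ∑ z ∈ Z, μ z * growthRatio l F (v - z) ≤ growthRatio l F v := by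
  have hθ (θ : ℝ) (h1 : θ < 1) :
      θ * ∑ z ∈ Z, μ z * growthRatio l F (v - z) ≤ growthRatio l F v := by
    apply le_growthRatio hl hpos hH
    have hev : ∀ᶠ x in l, ∀ z ∈ Z, θ * growthRatio l F (v - z) * F (x + v) ≤ F (x + z) := by
      rw [Filter.eventually_all_finset]
      intro z _
      have := eventually_mul_le_of_lt_growthRatio hl hpos hH (v := v - z)
        (mul_lt_of_lt_one_left (growthRatio_pos hl hpos hH (v - z)) h1)
      filter_upwards [(hl z).eventually this] with x hx
      rwa [add_assoc, add_sub_cancel] at hx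
    filter_upwards [hZ, hev] with x hx hx'
    refine le_trans ?_ hx
    rw [Finset.mul_sum, Finset.sum_mul]
    refine Finset.sum_le_sum fun z hz => ?_
    calc θ * (μ z * growthRatio l F (v - z)) * F (x + v)
        = μ z * (θ * growthRatio l F (v - z) * F (x + v)) := by ring
      _ ≤ μ z * F (x + z) := mul_le_mul_of_nonneg_left (hx' z hz) (hnn z)
  by_contra! hlt
  have hr := growthRatio_pos hl hpos hH v
  obtain ⟨θ, hθ1, hθ2⟩ := exists_between ((div_lt_one (hr.trans hlt)).mpr hlt)
  rw [div_lt_iff₀ (hr.trans hlt)] at hθ1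
  exact (hθ θ hθ2).not_gt hθ1

lemma growthRatio_mul_le [l.NeBot] (hl : ∀ v, Tendsto (· + v) l l)
    (hpos : ∀ᶠ x in l, 0 < F x) (hH : ∀ v, ∃ δ > 0, ∀ᶠ x in l, δ * F (x + v) ≤ F x)
    (v w : Fin d → ℤ) :
    growthRatio l F v * growthRatio l F w ≤ growthRatio l F (v + w) := by
  have hv := growthRatio_pos hl hpos hH v
  have hw := growthRatio_pos hl hpos hH w
  refine mul_le_of_forall_lt_of_nonneg hv.le (growthRatio_pos hl hpos hH _).le
    fun c hc hcv c' hc' hcw => le_growthRatio hl hpos hH ?_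
  filter_upwards [eventually_mul_le_of_lt_growthRatio hl hpos hH hcv,
    (hl v).eventually (eventually_mul_le_of_lt_growthRatio hl hpos hH hcw)] with x hx hx'
  rw [add_assoc] at hx'
  rw [mul_assoc]
  exact (mul_le_mul_of_nonneg_left hx' hc).trans hx

/-- If a function that is superharmonic along `l` grows exponentially along the `j`-th axis,
then some `a` with `a j > 0` satisfies `φ(a) ≤ 1`. -/
lemma exists_sum_exp_dotZ_le_one [l.NeBot] (hl : ∀ v, Tendsto (· + v) l l)
    (hpos : ∀ᶠ x in l, 0 < F x) (hH : ∀ v, ∃ δ > 0, ∀ᶠ x in l, δ * F (x + v) ≤ F x)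
    {μ : (Fin d → ℤ) → ℝ} (hnn : ∀ z, 0 ≤ μ z)
    (hZ : ∀ Z : Finset (Fin d → ℤ), ∀ᶠ x in l, ∑ z ∈ Z, μ z * F (x + z) ≤ F x)
    {j : Fin d} {κ : ℝ} (hκ : ∀ n : ℕ, 0 < n → ∀ c : ℝ, Real.exp (-(n * κ)) < c →
      ¬ ∀ᶠ x in l, c * F (x + n • Pi.single j 1) ≤ F x) :
    ∃ a : Fin d → ℝ, κ ≤ a j ∧ (∀ v, (∀ᶠ x in l, F (x + v) ≤ F x) → dotZ a v ≤ 0) ∧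
      ∀ Z : Finset (Fin d → ℤ), ∑ z ∈ Z, μ z * Real.exp (dotZ a z) ≤ 1 := by
  set r := growthRatio l F
  have hr : ∀ v, 0 < r v := growthRatio_pos hl hpos hH
  obtain ⟨a, haj, ha⟩ := exists_dotZ_le_of_subadditive (p := fun v => -Real.log (r v)) (j := j)
    (κ := κ) (fun v w => by
      have h := Real.log_le_log (mul_pos (hr v) (hr w)) (growthRatio_mul_le hl hpos hH v w)
      rw [Real.log_mul (hr v).ne' (hr w).ne'] at h
      linarith) (fun n hn => by
      have h : r (n • Pi.single j 1) ≤ Real.exp (-(n * κ)) := by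
        by_contra! hlt
        obtain ⟨c, hc1, hc2⟩ := exists_between hlt
        exact hκ n hn c hc1 (eventually_mul_le_of_lt_growthRatio hl hpos hH hc2)
      have := (Real.log_le_iff_le_exp (hr _)).mpr h
      linarith)
  refine ⟨a, haj, fun v hv => (ha v).trans ?_, fun Z => ?_⟩
  · exact neg_nonpos.mpr (Real.log_nonneg (le_growthRatio hl hpos hH (by simpa using hv)))
  have hra (v : Fin d → ℤ) : r v * Real.exp (dotZ a v) ≤ 1 := by
    rw [← Real.exp_log (hr v), ← Real.exp_add, Real.exp_le_one_iff]
    linarith [ha v]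
  obtain ⟨R, hR⟩ : ∃ R : ℕ, ∀ z ∈ Z, ∀ i, |z i| ≤ R := by
    refine ⟨∑ z ∈ Z, ∑ i, (z i).natAbs, fun z hz i => ?_⟩
    rw [Int.abs_eq_natAbs]
    exact_mod_cast (Finset.single_le_sum (f := fun i => (z i).natAbs) (by simp)
      (Finset.mem_univ i)).trans
      (Finset.single_le_sum (f := fun z : Fin d → ℤ => ∑ i, (z i).natAbs) (by simp) hz)
  set box : ℕ → Finset (Fin d → ℤ) :=
    fun n => Fintype.piFinset fun _ => Finset.Icc (-(n * R : ℤ)) (n * R)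
  have hsum (n : ℕ) : (∑ z ∈ Z, μ z * Real.exp (dotZ a z)) ^ n ≤
      ∑ v ∈ box n, r v * Real.exp (dotZ a v) := by
    induction n with
    | zero =>
      rw [pow_zero]
      have h0 : 1 ≤ r 0 := le_growthRatio hl hpos hH (by simp)
      refine le_trans ?_ (Finset.single_le_sum (f := fun v => r v * Real.exp (dotZ a v))
        (fun v _ => mul_nonneg (hr v).le (Real.exp_nonneg _)) (a := 0)
        (Fintype.mem_piFinset.mpr fun _ => Finset.mem_Icc.mpr (by simp)))
      simpa [dotZ] using h0
    | succ n ih =>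
      rw [pow_succ']
      calc (∑ z ∈ Z, μ z * Real.exp (dotZ a z)) * (∑ z ∈ Z, μ z * Real.exp (dotZ a z)) ^ n
          ≤ (∑ z ∈ Z, μ z * Real.exp (dotZ a z)) * ∑ v ∈ box n, r v * Real.exp (dotZ a v) :=
            mul_le_mul_of_nonneg_left ih
              (Finset.sum_nonneg fun z _ => mul_nonneg (hnn z) (Real.exp_nonneg _))
        _ = ∑ z ∈ Z, ∑ v ∈ box n, μ z * r v * Real.exp (dotZ a (v + z)) := by
            rw [Finset.sum_mul_sum]
            refine Finset.sum_congr rfl fun z _ => Finset.sum_congr rfl fun v _ => ?_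
            rw [dotZ_add, Real.exp_add]
            ring
        _ ≤ ∑ z ∈ Z, ∑ v ∈ box (n + 1), μ z * r (v - z) * Real.exp (dotZ a v) := by
            refine Finset.sum_le_sum fun z hz => ?_
            rw [← Finset.sum_image (s := box n) (g := (· + z))
              (f := fun v => μ z * r (v - z) * Real.exp (dotZ a v))
              (fun _ _ _ _ h => add_right_cancel h) |>.trans
              (Finset.sum_congr rfl fun v _ => by rw [add_sub_cancel_right])]
            refine Finset.sum_le_sum_of_subset_of_nonneg (fun v hv => ?_) fun v _ _ =>
              mul_nonneg (mul_nonneg (hnn z) (hr _).le) (Real.exp_nonneg _)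
            obtain ⟨w, hw, rfl⟩ := Finset.mem_image.mp hv
            simp only [box, Fintype.mem_piFinset, Finset.mem_Icc, Pi.add_apply] at hw ⊢
            intro i
            have h1 := hw i
            have h2 := abs_le.mp (hR z hz i)
            push_cast
            constructor <;> linarith [h1.1, h1.2, h2.1, h2.2]
        _ ≤ ∑ v ∈ box (n + 1), r v * Real.exp (dotZ a v) := by
            rw [Finset.sum_comm]
            refine Finset.sum_le_sum fun v _ => ?_
            rw [← Finset.sum_mul]
            exact mul_le_mul_of_nonneg_right (sum_mul_growthRatio_le hl hpos hH hnn (hZ Z) v)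
              (Real.exp_nonneg _)
  refine le_one_of_pow_le_polynomial (K := (2 * R + 1) ^ d) d fun n => (hsum n).trans ?_
  refine (Finset.sum_le_card_nsmul _ _ 1 fun v _ => hra v).trans ?_
  have hcard : (box n).card = (2 * (n * R) + 1) ^ d := by
    simp only [box, Fintype.card_piFinset, Int.card_Icc, Finset.prod_const, Finset.card_univ,
      Fintype.card_fin]
    congr 1
    have : (0 : ℤ) ≤ n * R := by positivity
    zify
    rw [Int.toNat_of_nonneg (by linarith)]
    ring
  rw [hcard, nsmul_eq_mul, mul_one, ← mul_pow]
  push_cast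
  refine pow_le_pow_left₀ (by positivity) ?_ d
  nlinarith [(Nat.cast_nonneg n : (0 : ℝ) ≤ n), (Nat.cast_nonneg R : (0 : ℝ) ≤ R)]

end GrowthRatio

section ExponentialMoments

variable {d : ℕ} {μ : (Fin d → ℤ) → ℝ}

lemma exp_le_one_add_add_sq (x : ℝ) : Real.exp x ≤ 1 + x + x ^ 2 * Real.exp |x| := by
  have h1 : Real.exp x ≤ 1 + x * Real.exp x := by
    have h := mul_le_mul_of_nonneg_right (Real.one_sub_le_exp_neg x) (Real.exp_nonneg x)
    rw [← Real.exp_add, neg_add_cancel, Real.exp_zero] at h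
    linarith
  rcases le_total 0 x with hx | hx
  · rw [abs_of_nonneg hx]
    nlinarith
  · nlinarith [Real.add_one_le_exp x, Real.one_le_exp (abs_nonneg x), sq_nonneg x]

lemma exp_abs_le (x : ℝ) : Real.exp |x| ≤ Real.exp x + Real.exp (-x) := by
  rcases abs_cases x with ⟨h, -⟩ | ⟨h, -⟩ <;> rw [h] <;>
    linarith [Real.exp_pos x, Real.exp_pos (-x)]

lemma phiE_zero (hnn : ∀ z, 0 ≤ μ z) (hsum : HasSum μ 1) : phiE μ 0 = 1 := by
  simp [phiE, dotZ, ← ENNReal.ofReal_tsum_of_nonneg hnn hsum.summable, hsum.tsum_eq]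

lemma exists_pos_summable_exp (hnn : ∀ z, 0 ≤ μ z) (hsum : HasSum μ 1) (hA2 : A2 μ)
    (b : Fin d → ℝ) :
    ∃ t > 0, Summable (fun z => μ z * Real.exp (t * dotZ b z)) ∧
      Summable (fun z => μ z * Real.exp (-(t * dotZ b z))) := by
  obtain ⟨U, hU, hDU, hfin⟩ := hA2
  have h0 : (0 : Fin d → ℝ) ∈ U := hDU (by simp [Dset, phiE_zero hnn hsum])
  have hev (s : ℝ) : ∀ᶠ t : ℝ in 𝓝[>] 0, (s * t) • b ∈ U := by
    have : Continuous fun t : ℝ => (s * t) • b := by fun_prop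
    exact nhdsWithin_le_nhds (this.continuousAt.eventually_mem (hU.mem_nhds (by simpa using h0)))
  have hsummable {c : Fin d → ℝ} (hc : c ∈ U) : Summable fun z => μ z * Real.exp (dotZ c z) := by
    have h := ENNReal.summable_toReal (hfin c hc)
    refine h.congr fun z => ENNReal.toReal_ofReal (mul_nonneg (hnn z) (Real.exp_nonneg _))
  obtain ⟨t, ⟨h1, h2⟩, ht⟩ := (((hev 1).and (hev (-1))).and self_mem_nhdsWithin).exists
  refine ⟨t, ht, ?_, ?_⟩
  · simpa [dotZ_smul] using hsummable h1
  · simpa only [dotZ_smul, neg_mul, one_mul] using hsummable h2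

lemma summable_mul_dotZ (hnn : ∀ z, 0 ≤ μ z) (hsum : HasSum μ 1) (hA2 : A2 μ) (b : Fin d → ℝ) :
    Summable fun z => μ z * dotZ b z := by
  obtain ⟨t, ht, h1, h2⟩ := exists_pos_summable_exp hnn hsum hA2 b
  refine .of_norm_bounded (g := fun z => t⁻¹ *
    (μ z * Real.exp (t * dotZ b z) + μ z * Real.exp (-(t * dotZ b z))))
    ((h1.add h2).mul_left _) fun z => ?_
  rw [Real.norm_eq_abs, abs_mul, abs_of_nonneg (hnn z), ← mul_add, mul_left_comm]
  refine mul_le_mul_of_nonneg_left ?_ (hnn z)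
  rw [le_inv_mul_iff₀ ht]
  refine le_trans ?_ (exp_abs_le _)
  rw [abs_mul, abs_of_pos ht]
  linarith [Real.add_one_le_exp (t * |dotZ b z|)]

lemma hasSum_mul_dotZ (hnn : ∀ z, 0 ≤ μ z) (hsum : HasSum μ 1) (hA2 : A2 μ) (b : Fin d → ℝ) :
    HasSum (fun z => μ z * dotZ b z) (dotR b (Mvec μ)) := by
  have hi (i : Fin d) : HasSum (fun z => μ z * (z i : ℝ)) (Mvec μ i) := by
    have h := summable_mul_dotZ hnn hsum hA2 (Pi.single i 1)
    have h' (z : Fin d → ℤ) : dotZ (Pi.single i 1) z = z i := by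
      simp [dotZ, Pi.single_apply]
    simp only [h'] at h
    exact h.hasSum
  have h := hasSum_sum (s := Finset.univ) fun i _ => (hi i).mul_left (b i)
  refine h.congr_fun fun z => ?_
  simp only [dotZ, Finset.mul_sum]
  exact Finset.sum_congr rfl fun i _ => mul_left_comm _ _ _

/-- Along a direction of negative mean, `φ ≤ 1` near the origin. -/
lemma eventually_phiE_smul_le_one (hnn : ∀ z, 0 ≤ μ z) (hsum : HasSum μ 1) (hA2 : A2 μ)
    {b : Fin d → ℝ} (hb : dotR b (Mvec μ) < 0) : ∀ᶠ t : ℝ in 𝓝[>] 0, phiE μ (t • b) ≤ 1 := by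
  obtain ⟨t₀, ht₀, h1, h2⟩ := exists_pos_summable_exp hnn hsum hA2 b
  set c : ℝ := (t₀ / 2)⁻¹ ^ 2 * 2
  have hc : 0 ≤ c := by positivity
  set u : (Fin d → ℤ) → ℝ :=
    fun z => μ z * Real.exp (t₀ * dotZ b z) + μ z * Real.exp (-(t₀ * dotZ b z))
  have hu : Summable u := h1.add h2
  have hbound {t : ℝ} (ht : 0 < t) (htt : t ≤ t₀ / 2) (z : Fin d → ℤ) :
      μ z * Real.exp (dotZ (t • b) z) ≤ μ z + t * (μ z * dotZ b z) + t ^ 2 * c * u z := by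
    rw [dotZ_smul]
    set s := dotZ b z with hs
    have e1 := exp_le_one_add_add_sq (t * s)
    have e2 : s ^ 2 ≤ c * Real.exp (t₀ / 2 * |s|) := by
      have := Real.quadratic_le_exp_of_nonneg (x := t₀ / 2 * |s|) (by positivity)
      have h3 : (t₀ / 2) ^ 2 * s ^ 2 ≤ 2 * Real.exp (t₀ / 2 * |s|) := by
        rw [← sq_abs s, ← mul_pow]
        nlinarith [mul_nonneg (half_pos ht₀).le (abs_nonneg s)]
      simp only [c]
      rw [inv_pow, mul_assoc, le_inv_mul_iff₀ (by positivity)]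
      exact h3
    have e3 : Real.exp |t * s| ≤ Real.exp (t₀ / 2 * |s|) := by
      rw [abs_mul, abs_of_pos ht]
      gcongr
    have e4 : Real.exp (t₀ / 2 * |s|) * Real.exp (t₀ / 2 * |s|) ≤
        Real.exp (t₀ * s) + Real.exp (-(t₀ * s)) := by
      rw [← Real.exp_add]
      refine le_trans (le_of_eq ?_) (exp_abs_le _)
      rw [abs_mul, abs_of_pos ht₀]
      ring_nf
    have e5 : (t * s) ^ 2 * Real.exp |t * s| ≤
        t ^ 2 * c * (Real.exp (t₀ * s) + Real.exp (-(t₀ * s))) :=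
      calc (t * s) ^ 2 * Real.exp |t * s|
          = t ^ 2 * (s ^ 2 * Real.exp |t * s|) := by ring
        _ ≤ t ^ 2 * (c * Real.exp (t₀ / 2 * |s|) * Real.exp (t₀ / 2 * |s|)) := by gcongr
        _ = t ^ 2 * c * (Real.exp (t₀ / 2 * |s|) * Real.exp (t₀ / 2 * |s|)) := by ring
        _ ≤ _ := by gcongr
    calc μ z * Real.exp (t * s)
        ≤ μ z * (1 + t * s + t ^ 2 * c * (Real.exp (t₀ * s) + Real.exp (-(t₀ * s)))) :=
          mul_le_mul_of_nonneg_left (by linarith) (hnn z)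
      _ = _ := by simp only [u, ← hs]; ring
  have hsmall : ∀ᶠ t : ℝ in 𝓝[>] 0, t * (c * ∑' z, u z) < -dotR b (Mvec μ) := by
    have : Continuous fun t : ℝ => t * (c * ∑' z, u z) := by fun_prop
    exact nhdsWithin_le_nhds (this.continuousAt.eventually_lt_const (by simpa using hb))
  filter_upwards [hsmall, self_mem_nhdsWithin,
    nhdsWithin_le_nhds (Iic_mem_nhds (half_pos ht₀))] with t ht ht0 htt
  have ht0 : 0 < t := ht0
  have hG := (hsum.add ((hasSum_mul_dotZ hnn hsum hA2 b).mul_left t)).add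
    (hu.hasSum.mul_left (t ^ 2 * c))
  have hpos (z : Fin d → ℤ) : 0 ≤ μ z * Real.exp (dotZ (t • b) z) :=
    mul_nonneg (hnn z) (Real.exp_nonneg _)
  have hs : Summable fun z => μ z * Real.exp (dotZ (t • b) z) :=
    .of_nonneg_of_le hpos (hbound ht0 htt) hG.summable
  rw [phiE, ← ENNReal.ofReal_tsum_of_nonneg hpos hs, ← ENNReal.ofReal_one]
  refine ENNReal.ofReal_le_ofReal ((hs.tsum_le_tsum (hbound ht0 htt) hG.summable).trans ?_)
  rw [hG.tsum_eq]
  nlinarith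

/-- For a walk with zero mean in the direction `a ≠ 0`, `φ(a) > 1`. -/
lemma eq_zero_of_sum_exp_dotZ_le_one (hnn : ∀ z, 0 ≤ μ z) (hsum : HasSum μ 1) (hA1 : A1 μ)
    (hA2 : A2 μ) {a : Fin d → ℝ} (ha : dotR a (Mvec μ) = 0)
    (hZ : ∀ Z : Finset (Fin d → ℤ), ∑ z ∈ Z, μ z * Real.exp (dotZ a z) ≤ 1) : a = 0 := by
  have hpos (z : Fin d → ℤ) : 0 ≤ μ z * Real.exp (dotZ a z) :=
    mul_nonneg (hnn z) (Real.exp_nonneg _)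
  have hs : Summable fun z => μ z * Real.exp (dotZ a z) := summable_of_sum_le hpos hZ
  have hlin := hsum.add (hasSum_mul_dotZ hnn hsum hA2 a)
  have hdiff := hs.hasSum.sub hlin
  have hnonneg (z : Fin d → ℤ) : 0 ≤ μ z * Real.exp (dotZ a z) - (μ z + μ z * dotZ a z) := by
    nlinarith [Real.add_one_le_exp (dotZ a z), hnn z]
  have hzero := (hasSum_zero_iff_of_nonneg hnonneg).mp (by
    have h1 := hs.tsum_le_of_sum_le hZ
    have h2 := hdiff.nonneg hnonneg
    rw [ha] at hdiff h2
    have h3 : ∑' z, μ z * Real.exp (dotZ a z) - (1 + 0) = 0 := by linarith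
    rwa [h3] at hdiff)
  have hstep (z : Fin d → ℤ) (hz : 0 < μ z) : dotZ a z = 0 := by
    by_contra hne
    have h1 := congrFun hzero z
    simp only [Pi.zero_apply] at h1
    nlinarith [Real.add_one_lt_exp hne]
  ext j
  obtain ⟨k, c, h0, hk, -, hc⟩ := hA1 ∅ 0 (fun i hi => hi.elim) (Pi.single j 1) fun i hi => hi.elim
  have hpath (m : ℕ) (hm : m ≤ k) : dotZ a (c m) = 0 := by
    induction m with
    | zero => rw [h0]; simp [dotZ]
    | succ m ih =>
      rw [← sub_add_cancel (c (m + 1)) (c m), dotZ_add, hstep _ (hc m hm), ih (by omega), add_zero]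
  simpa [hk, dotZ_single] using hpath k le_rfl

end ExponentialMoments

section PathBounds

variable {V : Type*} [AddCommGroup V] {μ : V → ℝ}

/-- Harnack inequality along a path from `p` to `q`. -/
lemma Irred.exists_mul_le {A : Set V} (hA : Irred μ A) {p q : V} (hp : p ∈ A) (hq : q ∈ A) :
    ∃ δ > 0, ∀ H : V → ℝ, (∀ x ∈ A, ∀ y ∈ A, μ (y - x) * H y ≤ H x) → δ * H q ≤ H p := by
  obtain ⟨k, c, h0, hk, hc, hμ⟩ := hA p hp q hq
  have key (m : ℕ) (hm : m ≤ k) : ∃ δ > 0, ∀ H : V → ℝ,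
      (∀ x ∈ A, ∀ y ∈ A, μ (y - x) * H y ≤ H x) → δ * H (c m) ≤ H p := by
    induction m with
    | zero => exact ⟨1, one_pos, fun H _ => by rw [h0, one_mul]⟩
    | succ m ih =>
      obtain ⟨δ, hδ, h⟩ := ih (by omega)
      refine ⟨δ * μ (c (m + 1) - c m), mul_pos hδ (hμ m hm), fun H hH => ?_⟩
      rw [mul_assoc]
      exact (mul_le_mul_of_nonneg_left (hH _ (hc m (by omega)) _ (hc (m + 1) hm)) hδ.le).trans
        (h H hH)
  simpa [hk] using key k le_rfl

end PathBounds

section Lift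

variable {d : ℕ} {μ : (Fin d → ℤ) → ℝ}

/-- A positive harmonic function of the projected walk lifts to a harmonic function. -/
lemma ofReal_comp_projL_eq (hnn : ∀ z, 0 ≤ μ z) (hsum : HasSum μ 1) {Λ : Set (Fin d)}
    {f : (↥Λ → ℤ) → ℝ} (hf : ∀ u ∈ posL Λ, 0 < f u) (hharm : HarmOn (muL μ Λ) (posL Λ) f)
    {x : Fin d → ℤ} (hx : x ∈ posDom Λ) :
    ENNReal.ofReal (f (projL Λ x)) = ∑' y, if y ∈ posDom Λ then
      ENNReal.ofReal (μ (y - x)) * ENNReal.ofReal (f (projL Λ y)) else 0 := by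
  have hmem (y : Fin d → ℤ) : y ∈ posDom Λ ↔ projL Λ y ∈ posL Λ := by
    simp [posDom, posL, projL]
  have hu := (hmem x).mp hx
  have hmu0 (v : ↥Λ → ℤ) : 0 ≤ muL μ Λ v :=
    tsum_nonneg fun z => by split_ifs; exacts [hnn z, le_rfl]
  have hmu (v : ↥Λ → ℤ) : ENNReal.ofReal (muL μ Λ (v - projL Λ x)) =
      ∑' y, if projL Λ y = v then ENNReal.ofReal (μ (y - x)) else 0 := by
    have hnn' (z : Fin d → ℤ) : 0 ≤ if projL Λ z = v - projL Λ x then μ z else 0 := by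
      split_ifs; exacts [hnn z, le_rfl]
    rw [muL, ENNReal.ofReal_tsum_of_nonneg hnn' (.of_nonneg_of_le hnn' (fun z => by
      split_ifs; exacts [le_rfl, hnn z]) hsum.summable), ← (Equiv.subRight x).tsum_eq]
    refine tsum_congr fun y => ?_
    have : projL Λ (Equiv.subRight x y) = v - projL Λ x ↔ projL Λ y = v := by
      rw [← sub_left_inj (a := projL Λ x) (b := projL Λ y)]; rfl
    by_cases h : projL Λ y = v
    · rw [if_pos h, if_pos (this.mpr h)]; rfl
    · rw [if_neg h, if_neg (mt this.mp h), ENNReal.ofReal_zero]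
  have hnn' (v : ↥Λ → ℤ) :
      0 ≤ if v ∈ posL Λ then muL μ Λ (v - projL Λ x) * f v else 0 := by
    split_ifs with hv
    exacts [mul_nonneg (hmu0 _) (hf v hv).le, le_rfl]
  have hsm : Summable fun v => if v ∈ posL Λ then muL μ Λ (v - projL Λ x) * f v else 0 := by
    by_contra hns
    have h := hharm _ hu
    rw [tsum_eq_zero_of_not_summable hns] at h
    exact (hf _ hu).ne' h
  rw [hharm _ hu, ENNReal.ofReal_tsum_of_nonneg hnn' hsm]
  calc ∑' v, ENNReal.ofReal (if v ∈ posL Λ then muL μ Λ (v - projL Λ x) * f v else 0)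
      = ∑' v, ∑' y, if projL Λ y = v then (if y ∈ posDom Λ then
          ENNReal.ofReal (μ (y - x)) * ENNReal.ofReal (f (projL Λ y)) else 0) else 0 := by
        refine tsum_congr fun v => ?_
        by_cases hv : v ∈ posL Λ
        · rw [if_pos hv, ENNReal.ofReal_mul (hmu0 _), hmu, ← ENNReal.tsum_mul_right]
          refine tsum_congr fun y => ?_
          by_cases hy : projL Λ y = v
          · subst hy
            rw [if_pos rfl, if_pos rfl, if_pos ((hmem y).mpr hv)]
          · rw [if_neg hy, if_neg hy, zero_mul]
        · rw [if_neg hv, ENNReal.ofReal_zero, eq_comm, ENNReal.tsum_eq_zero]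
          intro y
          split_ifs with hy hy'
          exacts [absurd (hy ▸ (hmem y).mp hy') hv, rfl, rfl]
    _ = _ := by
        rw [ENNReal.tsum_comm]
        exact tsum_congr fun y => by
          rw [tsum_eq_single (projL Λ y) fun v hv => if_neg hv.symm, if_pos rfl]

/-- Finite truncations of the mean value property. -/
lemma sum_mul_le_of_ofReal_eq (hnn : ∀ z, 0 ≤ μ z) {B : Set (Fin d → ℤ)}
    {F : (Fin d → ℤ) → ℝ} (hF : ∀ x ∈ B, 0 < F x) {x : Fin d → ℤ} (hx : x ∈ B)
    (hE : ENNReal.ofReal (F x) = ∑' y, if y ∈ B then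
      ENNReal.ofReal (μ (y - x)) * ENNReal.ofReal (F y) else 0)
    {Z : Finset (Fin d → ℤ)} (hZ : ∀ z ∈ Z, x + z ∈ B) :
    ∑ z ∈ Z, μ z * F (x + z) ≤ F x := by
  rw [← ENNReal.ofReal_le_ofReal_iff (hF x hx).le, hE, ENNReal.ofReal_sum_of_nonneg
    fun z hz => mul_nonneg (hnn z) (hF _ (hZ z hz)).le]
  refine le_trans (le_of_eq ?_) (ENNReal.sum_le_tsum (Z.map (addLeftEmbedding x)))
  rw [Finset.sum_map]
  refine Finset.sum_congr rfl fun z hz => ?_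
  rw [addLeftEmbedding_apply, if_pos (hZ z hz), add_sub_cancel_left, ENNReal.ofReal_mul (hnn z)]

end Lift

section Growth

variable {d : ℕ} {μ : (Fin d → ℤ) → ℝ}

/-- The filter of points whose coordinates in `Λ` tend to infinity. -/
noncomputable def deepFilter (Λ : Set (Fin d)) : Filter (Fin d → ℤ) := comap (projL Λ) atTop

lemma eventually_deepFilter {Λ : Set (Fin d)} {P : (Fin d → ℤ) → Prop} :
    (∀ᶠ x in deepFilter Λ, P x) ↔ ∃ L : ℤ, ∀ x, (∀ i ∈ Λ, L ≤ x i) → P x := by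
  rw [deepFilter, eventually_comap, eventually_atTop]
  constructor
  · rintro ⟨u, hu⟩
    obtain ⟨L, hL⟩ := (Set.finite_range u).bddAbove
    exact ⟨L, fun x hx => hu _ (fun i => (hL ⟨i, rfl⟩).trans (hx i i.2)) x rfl⟩
  · rintro ⟨L, hL⟩
    exact ⟨fun _ => L, fun _ hv x hx => hL x fun i hi => by subst hx; exact hv ⟨i, hi⟩⟩

lemma tendsto_add_deepFilter (Λ : Set (Fin d)) (v : Fin d → ℤ) :
    Tendsto (· + v) (deepFilter Λ) (deepFilter Λ) := by
  intro s hs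
  obtain ⟨L, hL⟩ := eventually_deepFilter.mp hs
  obtain ⟨R, hR⟩ := (Set.finite_range v).bddBelow
  refine eventually_deepFilter.mpr ⟨L - R, fun x hx => hL _ fun i hi => ?_⟩
  have h1 := hx i hi
  have h2 := hR ⟨i, rfl⟩
  simp only [Pi.add_apply]
  omega

instance deepFilter_neBot (Λ : Set (Fin d)) : (deepFilter Λ).NeBot := by
  refine ⟨fun h => ?_⟩
  obtain ⟨L, hL⟩ := eventually_deepFilter.mp (h ▸ eventually_bot : ∀ᶠ _ in deepFilter Λ, False)
  exact hL (fun _ => L) fun _ _ => le_rfl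

lemma add_mem_posDom {Λ : Set (Fin d)} {t p : Fin d → ℤ} (ht : ∀ i ∈ Λ, 0 ≤ t i)
    (hp : p ∈ posDom Λ) : t + p ∈ posDom Λ :=
  fun i hi => add_pos_of_nonneg_of_pos (ht i hi) (hp i hi)

/-- Translation-uniform Harnack inequality for harmonic functions on `posDom Λ`. -/
lemma exists_mul_le_translate (hA1 : A1 μ) {Λ : Set (Fin d)}
    {F : (Fin d → ℤ) → ℝ}
    (hsup : ∀ x ∈ posDom Λ, ∀ Z : Finset (Fin d → ℤ), (∀ z ∈ Z, x + z ∈ posDom Λ) →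
      ∑ z ∈ Z, μ z * F (x + z) ≤ F x)
    {p q : Fin d → ℤ} (hp : p ∈ posDom Λ) (hq : q ∈ posDom Λ) :
    ∃ δ > 0, ∀ t : Fin d → ℤ, (∀ i ∈ Λ, 0 ≤ t i) → δ * F (t + q) ≤ F (t + p) := by
  obtain ⟨δ, hδ, h⟩ := (hA1 Λ).exists_mul_le hp hq
  refine ⟨δ, hδ, fun t ht => h (fun x => F (t + x)) fun x hx y hy => ?_⟩
  have heq : t + x + (y - x) = t + y := by abel
  have := hsup _ (add_mem_posDom ht hx) {y - x} fun z hz => by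
    rw [Finset.mem_singleton.mp hz, heq]
    exact add_mem_posDom ht hy
  simpa [heq] using this

/-- Positive harmonic functions on `posDom Λ`, where the coordinates in `Λ` have zero drift,
do not grow exponentially along any axis. -/
lemma exists_axis_step (hnn : ∀ z, 0 ≤ μ z) (hsum : HasSum μ 1) (hA1 : A1 μ) (hA2 : A2 μ)
    {Λ : Set (Fin d)} (hΛ : ∀ i ∈ Λ, Mvec μ i = 0) {F : (Fin d → ℤ) → ℝ}
    (hF : ∀ x ∈ posDom Λ, 0 < F x) (hFΛ : ∀ x y, (∀ i ∈ Λ, x i = y i) → F x = F y)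
    (hsup : ∀ x ∈ posDom Λ, ∀ Z : Finset (Fin d → ℤ), (∀ z ∈ Z, x + z ∈ posDom Λ) →
      ∑ z ∈ Z, μ z * F (x + z) ≤ F x)
    {κ : ℝ} (hκ : 0 < κ) (j : Fin d) :
    ∃ n : ℕ, 0 < n ∧ ∀ᶠ x in deepFilter Λ,
      F (x + n • Pi.single j 1) ≤ Real.exp (n * κ) * F x := by
  have hdeep (L : ℤ) : ∀ᶠ x in deepFilter Λ, ∀ i ∈ Λ, L ≤ x i :=
    eventually_deepFilter.mpr ⟨L, fun _ h => h⟩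
  have hpd : ∀ᶠ x in deepFilter Λ, x ∈ posDom Λ := (hdeep 1).mono fun x hx i hi => hx i hi
  have hpos : ∀ᶠ x in deepFilter Λ, 0 < F x := hpd.mono hF
  have hl := tendsto_add_deepFilter Λ
  by_contra! hcon
  obtain ⟨a, haj, haΛ, haZ⟩ := exists_sum_exp_dotZ_le_one (F := F) hl hpos (fun v => by
      obtain ⟨p, hp, hpv⟩ := (hpd.and ((hl v).eventually hpd)).exists
      obtain ⟨δ, hδ, h⟩ := exists_mul_le_translate hA1 hsup hp hpv
      obtain ⟨L, hL⟩ := (Set.finite_range p).bddAbove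
      refine ⟨δ, hδ, (hdeep L).mono fun x hx => ?_⟩
      have := h (x - p) fun i hi => sub_nonneg.mpr ((hL ⟨i, rfl⟩).trans (hx i hi))
      rwa [sub_add_cancel, ← add_assoc, sub_add_cancel] at this) hnn (fun Z => by
      have hall : ∀ᶠ x in deepFilter Λ, ∀ z ∈ Z, x + z ∈ posDom Λ := by
        rw [Filter.eventually_all_finset]
        exact fun z _ => (hl z).eventually hpd
      filter_upwards [hpd, hall] with x hx hx' using hsup x hx Z hx')
    (j := j) (κ := κ) (fun n hn c hc hev => by
      refine hcon n hn ?_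
      filter_upwards [hev, (hl (n • Pi.single j 1)).eventually hpos] with x hx hx'
      have := (mul_le_mul_of_nonneg_right hc.le hx'.le).trans hx
      rw [Real.exp_neg] at this
      rw [inv_mul_le_iff₀ (Real.exp_pos _)] at this
      exact this.not_gt)
  have hzero (i : Fin d) (hi : i ∉ Λ) : a i = 0 := by
    have h (n : ℤ) : dotZ a (Pi.single i n) ≤ 0 := by
      refine haΛ _ (Eventually.of_forall fun x => (hFΛ _ _ fun k hk => ?_).le)
      have : k ≠ i := fun h => hi (h ▸ hk)
      simp [this]
    have h1 := h 1
    have h2 := h (-1)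
    rw [dotZ_single] at h1 h2
    push_cast at h1 h2
    linarith
  have ha := eq_zero_of_sum_exp_dotZ_le_one hnn hsum hA1 hA2 (a := a)
    (Finset.sum_eq_zero fun i _ => by
      by_cases hi : i ∈ Λ
      · rw [hΛ i hi, mul_zero]
      · rw [hzero i hi, zero_mul]) haZ
  rw [ha, Pi.zero_apply] at haj
  exact haj.not_gt hκ

end Growth

section SubexponentialGrowth

variable {d : ℕ} {μ : (Fin d → ℤ) → ℝ}

lemma dotZ_indicator_nonneg {Λ : Set (Fin d)} {κ : ℝ} (hκ : 0 ≤ κ) {x : Fin d → ℤ}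
    (hx : ∀ i ∈ Λ, 0 ≤ x i) : 0 ≤ dotZ (Λ.indicator fun _ => κ) x := by
  refine Finset.sum_nonneg fun i _ => ?_
  by_cases hi : i ∈ Λ
  · rw [Set.indicator_of_mem hi]
    exact mul_nonneg hκ (by exact_mod_cast hx i hi)
  · rw [Set.indicator_of_notMem hi, zero_mul]

/-- Reduction of deep points along the axes to a bounded box. -/
lemma exists_le_exp_dotZ_of_axis_steps {Λ : Set (Fin d)} {F : (Fin d → ℤ) → ℝ}
    (hFΛ : ∀ x y, (∀ i ∈ Λ, x i = y i) → F x = F y) {κ : ℝ} (hκ : 0 < κ) {L : ℤ} (hL : 0 ≤ L)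
    {n : Fin d → ℕ} (hn : ∀ j, 0 < n j)
    (hstep : ∀ j, ∀ x, (∀ i ∈ Λ, L ≤ x i) →
      F (x + n j • Pi.single j 1) ≤ Real.exp (n j * κ) * F x) :
    ∃ C > 0, ∀ x, (∀ i ∈ Λ, L ≤ x i) → F x ≤ C * Real.exp (dotZ (Λ.indicator fun _ => κ) x) := by
  obtain ⟨C, hC⟩ := ((Set.finite_Icc (fun _ : Fin d => L) fun i => L + n i).image F).bddAbove
  refine ⟨max C 1, by positivity, fun x hx => ?_⟩
  induction hk : ∑ i, (if i ∈ Λ then (x i).toNat else 0) using Nat.strong_induction_on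
    generalizing x with
  | _ k ih =>
    by_cases hbox : ∀ i ∈ Λ, x i ≤ L + n i
    · have h1 : F x ≤ C := by
        rw [hFΛ x (fun i => if i ∈ Λ then x i else L) fun i hi => by simp [hi]]
        refine hC ⟨_, ⟨fun i => ?_, fun i => ?_⟩, rfl⟩
        · by_cases hi : i ∈ Λ
          · simpa [hi] using hx i hi
          · simp [hi]
        · by_cases hi : i ∈ Λ
          · simpa [hi] using hbox i hi
          · simp [hi]
      have h2 := Real.one_le_exp
        (dotZ_indicator_nonneg (Λ := Λ) hκ.le fun i hi => hL.trans (hx i hi))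
      calc F x ≤ max C 1 * 1 := by rw [mul_one]; exact h1.trans (le_max_left _ _)
        _ ≤ _ := by gcongr
    · push Not at hbox
      obtain ⟨j, hj, hlt⟩ := hbox
      set y := x - n j • Pi.single j 1 with hy
      have hyj : y j = x j - n j := by simp [hy]
      have hyi (i : Fin d) (hi : i ≠ j) : y i = x i := by simp [hy, hi]
      have hyL (i : Fin d) (hi : i ∈ Λ) : L ≤ y i := by
        by_cases hij : i = j
        · subst hij; omega
        · rw [hyi i hij]; exact hx i hi
      have hxy : x = y + n j • Pi.single j 1 := by rw [hy, sub_add_cancel]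
      have hdecr : ∑ i, (if i ∈ Λ then (y i).toNat else 0) < k := by
        rw [← hk]
        refine Finset.sum_lt_sum (fun i _ => ?_) ⟨j, Finset.mem_univ j, ?_⟩
        · by_cases hij : i = j
          · subst hij; rw [if_pos hj, if_pos hj]; omega
          · rw [hyi i hij]
        · have := hn j
          rw [if_pos hj, if_pos hj]
          omega
      have hdot : dotZ (Λ.indicator fun _ => κ) x =
          dotZ (Λ.indicator fun _ => κ) y + n j * κ := by
        have : n j • (Pi.single j 1 : Fin d → ℤ) = Pi.single j (n j : ℤ) := by
          rw [← Pi.single_smul]; simp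
        conv_lhs => rw [hxy, dotZ_add, this, dotZ_single, Set.indicator_of_mem hj]
        push_cast
        ring
      calc F x = F (y + n j • Pi.single j 1) := by rw [← hxy]
        _ ≤ Real.exp (n j * κ) * F y := hstep j y hyL
        _ ≤ Real.exp (n j * κ) * (max C 1 * Real.exp (dotZ (Λ.indicator fun _ => κ) y)) := by
            gcongr; exact ih _ hdecr y hyL rfl
        _ = _ := by rw [hdot, Real.exp_add]; ring

/-- Subexponential growth of positive harmonic functions on `posDom Λ`. -/
lemma exists_le_exp_dotZ (hnn : ∀ z, 0 ≤ μ z) (hsum : HasSum μ 1) (hA1 : A1 μ) (hA2 : A2 μ)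
    {Λ : Set (Fin d)} (hΛ : ∀ i ∈ Λ, Mvec μ i = 0) {F : (Fin d → ℤ) → ℝ}
    (hF : ∀ x ∈ posDom Λ, 0 < F x) (hFΛ : ∀ x y, (∀ i ∈ Λ, x i = y i) → F x = F y)
    (hsup : ∀ x ∈ posDom Λ, ∀ Z : Finset (Fin d → ℤ), (∀ z ∈ Z, x + z ∈ posDom Λ) →
      ∑ z ∈ Z, μ z * F (x + z) ≤ F x)
    {κ : ℝ} (hκ : 0 < κ) :
    ∃ C > 0, ∀ x ∈ posDom Λ, F x ≤ C * Real.exp (dotZ (Λ.indicator fun _ => κ) x) := by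
  choose n hn hev using exists_axis_step hnn hsum hA1 hA2 hΛ hF hFΛ hsup hκ
  obtain ⟨L₀, hL₀⟩ := eventually_deepFilter.mp (eventually_all.mpr hev)
  set L := max L₀ 0
  obtain ⟨C, hC, hCF⟩ := exists_le_exp_dotZ_of_axis_steps hFΛ hκ (le_max_right L₀ 0) hn
    fun j x hx => hL₀ x (fun i hi => (le_max_left _ _).trans (hx i hi)) j
  have hL0 : 0 ≤ L := le_max_right _ _
  set w : Fin d → ℤ := fun _ => L
  have hone : (1 : Fin d → ℤ) ∈ posDom Λ := fun i _ => by simp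
  obtain ⟨δ, hδ, h⟩ := exists_mul_le_translate hA1 hsup
    (add_mem_posDom (t := w) (fun _ _ => hL0) hone) hone
  refine ⟨δ⁻¹ * (C * Real.exp (dotZ (Λ.indicator fun _ => κ) w)), by positivity, fun x hx => ?_⟩
  have h1 := h (x - 1) fun i hi => by
    have := hx i hi
    simp only [Pi.sub_apply, Pi.one_apply]
    omega
  rw [sub_add_cancel, add_left_comm, sub_add_cancel] at h1
  have h2 := hCF (w + x) fun i hi => by
    have := hx i hi
    simp only [Pi.add_apply, w]
    omega
  rw [dotZ_add, Real.exp_add] at h2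
  rw [mul_assoc, le_inv_mul_iff₀ hδ]
  linarith

end SubexponentialGrowth

section Barrier

variable {d : ℕ} {μ : (Fin d → ℤ) → ℝ}

/-- The sum of exponentials `C exp(t (Σ_{k ∈ Λ} xᵏ - xⁱ))` over `i ∉ Λ`. -/
noncomputable def expBarrier (Λ : Set (Fin d)) (C t : ℝ) (x : Fin d → ℤ) : ENNReal :=
  ∑ i with i ∉ Λ, ENNReal.ofReal
    (C * Real.exp (dotZ (t • ((Λ.indicator fun _ => (1 : ℝ)) - Pi.single i 1)) x))

lemma tsum_mul_expBarrier_le {Λ : Set (Fin d)} {C t : ℝ} (hC : 0 ≤ C) (hnn : ∀ z, 0 ≤ μ z)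
    (hphi : ∀ i ∉ Λ, phiE μ (t • ((Λ.indicator fun _ => (1 : ℝ)) - Pi.single i 1)) ≤ 1)
    (x : Fin d → ℤ) :
    ∑' y, ENNReal.ofReal (μ (y - x)) * expBarrier Λ C t y ≤ expBarrier Λ C t x := by
  simp only [expBarrier, Finset.mul_sum]
  rw [Summable.tsum_finsetSum fun _ _ => ENNReal.summable]
  refine Finset.sum_le_sum fun i hi => ?_
  set a := t • ((Λ.indicator fun _ => (1 : ℝ)) - Pi.single i 1)
  calc ∑' y, ENNReal.ofReal (μ (y - x)) * ENNReal.ofReal (C * Real.exp (dotZ a y))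
      = ∑' y, ENNReal.ofReal (C * Real.exp (dotZ a x)) *
          ENNReal.ofReal (μ (y - x) * Real.exp (dotZ a (y - x))) := by
        refine tsum_congr fun y => ?_
        rw [← ENNReal.ofReal_mul (hnn _), ← ENNReal.ofReal_mul (by positivity)]
        congr 1
        have : dotZ a y = dotZ a x + dotZ a (y - x) := by rw [← dotZ_add, add_sub_cancel]
        rw [this, Real.exp_add]
        ring
    _ = ENNReal.ofReal (C * Real.exp (dotZ a x)) * phiE μ a := by
        rw [ENNReal.tsum_mul_left]
        congr 1
        exact (Equiv.subRight x).tsum_eq fun z => ENNReal.ofReal (μ z * Real.exp (dotZ a z))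
    _ ≤ ENNReal.ofReal (C * Real.exp (dotZ a x)) :=
        mul_le_of_le_one_right' (hphi i (Finset.mem_filter.mp hi).2)

/-- The barrier dominates `F` wherever a coordinate outside `Λ` is nonpositive. -/
lemma ofReal_le_expBarrier {Λ : Set (Fin d)} {C t : ℝ} (hC : 0 ≤ C) (ht : 0 ≤ t)
    {F : (Fin d → ℤ) → ℝ}
    (hF : ∀ x ∈ posDom Λ, F x ≤ C * Real.exp (dotZ (Λ.indicator fun _ => t) x))
    {x : Fin d → ℤ} (hx : x ∈ posDom Λ) (hx' : x ∉ posAll) :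
    ENNReal.ofReal (F x) ≤ expBarrier Λ C t x := by
  obtain ⟨i, hi⟩ : ∃ i, x i ≤ 0 := by by_contra! h; exact hx' h
  have hiΛ : i ∉ Λ := fun h => (hx i h).not_ge hi
  refine le_trans (ENNReal.ofReal_le_ofReal ((hF x hx).trans ?_))
    (Finset.single_le_sum (s := Finset.univ.filter (· ∉ Λ)) (f := fun i => ENNReal.ofReal
      (C * Real.exp (dotZ (t • ((Λ.indicator fun _ => (1 : ℝ)) - Pi.single i 1)) x)))
      (fun _ _ => zero_le) (by simpa using hiΛ))
  gcongr
  have hsplit : dotZ (t • ((Λ.indicator fun _ => (1 : ℝ)) - Pi.single i 1)) x =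
      dotZ (Λ.indicator fun _ => t) x - t * x i := by
    simp only [dotZ, Pi.smul_apply, Pi.sub_apply, smul_eq_mul, mul_sub, sub_mul,
      Finset.sum_sub_distrib]
    congr 1
    · refine Finset.sum_congr rfl fun k _ => ?_
      by_cases hk : k ∈ Λ <;> simp [hk]
    · simp [Pi.single_apply]
  have : (x i : ℝ) ≤ 0 := by exact_mod_cast hi
  rw [hsplit]
  nlinarith

/-- Moving into the quadrant along the coordinates outside `Λ`, the barrier vanishes. -/
lemma exists_expBarrier_lt {Λ : Set (Fin d)} {C t : ℝ} (ht : 0 < t) {ε : ENNReal} (hε : 0 < ε) :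
    ∃ x ∈ posAll, (∀ i ∈ Λ, x i = 1) ∧ expBarrier Λ C t x < ε := by
  set x : ℕ → Fin d → ℤ := fun n i => if i ∈ Λ then 1 else n + 1
  have hlim : Tendsto (fun n => expBarrier Λ C t (x n)) atTop (𝓝 0) := by
    rw [← Finset.sum_const_zero (s := Finset.univ.filter (· ∉ Λ))]
    refine tendsto_finsetSum _ fun i hi => ?_
    have hi' : i ∉ Λ := (Finset.mem_filter.mp hi).2
    have hdot (n : ℕ) : dotZ (t • ((Λ.indicator fun _ => (1 : ℝ)) - Pi.single i 1)) (x n) =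
        t * ((∑ k, Λ.indicator (fun _ => (1 : ℝ)) k - 1) + -n) := by
      rw [dotZ_smul]
      congr 1
      simp only [dotZ, Pi.sub_apply, sub_mul, Finset.sum_sub_distrib]
      have h1 : ∑ k, Λ.indicator (fun _ => (1 : ℝ)) k * (x n k : ℝ) =
          ∑ k, Λ.indicator (fun _ => (1 : ℝ)) k :=
        Finset.sum_congr rfl fun k _ => by by_cases hk : k ∈ Λ <;> simp [hk, x]
      have h2 : ∑ k, (Pi.single i 1 : Fin d → ℝ) k * (x n k : ℝ) = n + 1 := by
        rw [Finset.sum_eq_single i (fun k _ hk => by simp [hk]) (by simp)]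
        simp [x, hi']
      rw [h1, h2]
      ring
    simp only [hdot]
    rw [← ENNReal.ofReal_zero, ← mul_zero C]
    refine ENNReal.tendsto_ofReal ((Real.tendsto_exp_atBot.comp ?_).const_mul C)
    exact (tendsto_atBot_add_const_left _ _
      (tendsto_neg_atTop_atBot.comp tendsto_natCast_atTop_atTop)).const_mul_atBot ht
  obtain ⟨n, hn⟩ := (hlim.eventually_lt_const hε).exists
  refine ⟨x n, fun i => ?_, fun i hi => by simp [x, hi], hn⟩
  simp only [x]
  split_ifs <;> omega

end Barrier

section Correction

variable {V : Type*} [AddCommGroup V] {μ : V → ℝ}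

lemma exitReward_add_tsum (hnn : ∀ z, 0 ≤ μ z) {A B : Set V} (hAB : A ⊆ B) {F : V → ℝ} {x : V}
    (hE : ENNReal.ofReal (F x) = ∑' y, if y ∈ B then
      ENNReal.ofReal (μ (y - x)) * ENNReal.ofReal (F y) else 0) :
    exitReward μ A B F x + (∑' z, if z ∈ A then
      ENNReal.ofReal (μ (z - x)) * ENNReal.ofReal (F z) else 0) = ENNReal.ofReal (F x) := by
  rw [hE, exitReward, ← ENNReal.tsum_add]
  refine tsum_congr fun y => ?_
  by_cases hA : y ∈ A
  · simp [hA, hAB hA]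
  · by_cases hB : y ∈ B <;> simp [hA, hB, ENNReal.ofReal_mul (hnn _)]

variable {A B : Set V} {F : V → ℝ}

lemma exitExpE_le_ofReal (hnn : ∀ z, 0 ≤ μ z) (hsum : HasSum μ 1) (hAB : A ⊆ B)
    (hE : ∀ x ∈ B, ENNReal.ofReal (F x) = ∑' y, if y ∈ B then
      ENNReal.ofReal (μ (y - x)) * ENNReal.ofReal (F y) else 0)
    {x : V} (hx : x ∈ A) : exitExpE μ A B F x ≤ ENNReal.ofReal (F x) :=
  exitExpE_le hnn hsum (fun _ hz => (exitReward_add_tsum hnn hAB (hE _ (hAB hz))).le) hx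

/-- Subtracting the expected value at the exit from `A` makes `F` harmonic for the walk killed
upon leaving `A`. -/
lemma hasSum_mul_sub_exitExpE (hnn : ∀ z, 0 ≤ μ z) (hsum : HasSum μ 1) (hAB : A ⊆ B)
    (hF : ∀ x ∈ B, 0 < F x)
    (hE : ∀ x ∈ B, ENNReal.ofReal (F x) = ∑' y, if y ∈ B then
      ENNReal.ofReal (μ (y - x)) * ENNReal.ofReal (F y) else 0)
    {x : V} (hx : x ∈ A) :
    HasSum (fun y => if y ∈ A then μ (y - x) * (F y - (exitExpE μ A B F y).toReal) else 0)
      (F x - (exitExpE μ A B F x).toReal) := by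
  have hle {z : V} (hz : z ∈ A) := exitExpE_le_ofReal hnn hsum hAB hE hz
  have h1 := exitReward_add_tsum hnn hAB (hE x (hAB hx))
  have h2 := exitExpE_eq_add hnn hsum B F hx
  set u : V → ENNReal := fun z => if z ∈ A then
    ENNReal.ofReal (μ (z - x)) * ENNReal.ofReal (F z) else 0
  set v : V → ENNReal := fun z => ENNReal.ofReal (μ (z - x)) * exitExpE μ A B F z
  have hfin1 := ENNReal.add_ne_top.mp (h1 ▸ ENNReal.ofReal_ne_top)
  have hfin2 := ENNReal.add_ne_top.mp (h2 ▸ ne_top_of_le_ne_top ENNReal.ofReal_ne_top (hle hx))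
  have hu := (ENNReal.hasSum_toReal hfin1.2).sub (ENNReal.hasSum_toReal hfin2.2)
  rw [← ENNReal.tsum_toReal_eq fun z => ENNReal.ne_top_of_tsum_ne_top hfin1.2 z,
    ← ENNReal.tsum_toReal_eq fun z => ENNReal.ne_top_of_tsum_ne_top hfin2.2 z] at hu
  have h1' : F x = (exitReward μ A B F x).toReal + (∑' z, u z).toReal := by
    rw [← ENNReal.toReal_add hfin1.1 hfin1.2, h1, ENNReal.toReal_ofReal (hF x (hAB hx)).le]
  have h2' : (exitExpE μ A B F x).toReal =
      (exitReward μ A B F x).toReal + (∑' z, v z).toReal := by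
    rw [← ENNReal.toReal_add hfin2.1 hfin2.2, h2]
  have h3 : F x - (exitExpE μ A B F x).toReal = (∑' z, u z).toReal - (∑' z, v z).toReal := by
    rw [h1', h2', add_sub_add_left_eq_sub]
  rw [h3]
  refine (congrArg (HasSum · _) (funext fun z => ?_)).mpr hu
  by_cases hz : z ∈ A
  · simp only [if_pos hz, ENNReal.toReal_mul, ENNReal.toReal_ofReal (hnn _),
      ENNReal.toReal_ofReal (hF z (hAB hz)).le]
    ring
  · simp [hz, exitExpE_of_notMem]

/-- By irreducibility, strict positivity of the corrected function at one point propagates to all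
of `A`. -/
lemma toReal_exitExpE_lt (hnn : ∀ z, 0 ≤ μ z) (hsum : HasSum μ 1) (hA : Irred μ A) (hAB : A ⊆ B)
    (hF : ∀ x ∈ B, 0 < F x)
    (hE : ∀ x ∈ B, ENNReal.ofReal (F x) = ∑' y, if y ∈ B then
      ENNReal.ofReal (μ (y - x)) * ENNReal.ofReal (F y) else 0)
    {x₀ : V} (hx₀ : x₀ ∈ A) (hlt : exitExpE μ A B F x₀ < ENNReal.ofReal (F x₀))
    {x : V} (hx : x ∈ A) : (exitExpE μ A B F x).toReal < F x := by
  have hnonneg {z : V} (hz : z ∈ A) : 0 ≤ F z - (exitExpE μ A B F z).toReal :=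
    sub_nonneg.mpr (ENNReal.toReal_le_of_le_ofReal (hF z (hAB hz)).le
      (exitExpE_le_ofReal hnn hsum hAB hE hz))
  obtain ⟨δ, hδ, h⟩ := hA.exists_mul_le hx hx₀
  have hpos : 0 < F x₀ - (exitExpE μ A B F x₀).toReal := by
    rw [sub_pos, ← ENNReal.toReal_ofReal (hF x₀ (hAB hx₀)).le]
    exact ENNReal.toReal_strict_mono ENNReal.ofReal_ne_top hlt
  refine sub_pos.mp ((mul_pos hδ hpos).trans_le
    (h (fun z => F z - (exitExpE μ A B F z).toReal) fun y hy z hz => ?_))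
  refine le_trans (le_of_eq ?_)
    (le_hasSum (hasSum_mul_sub_exitExpE hnn hsum hAB hF hE hy) z fun w _ => ?_)
  · rw [if_pos hz]
  · split_ifs with hw
    exacts [mul_nonneg (hnn _) (hnonneg hw), le_rfl]

end Correction

section Positivity

variable {d : ℕ} {μ : (Fin d → ℤ) → ℝ}

lemma posAll_subset_posDom (Λ : Set (Fin d)) : posAll ⊆ posDom Λ := fun _ hx i _ => hx i

lemma exitExpE_le_expBarrier (hnn : ∀ z, 0 ≤ μ z) (hsum : HasSum μ 1) {Λ : Set (Fin d)}
    {C t : ℝ} (hC : 0 ≤ C) (ht : 0 ≤ t) {F : (Fin d → ℤ) → ℝ}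
    (hF : ∀ x ∈ posDom Λ, F x ≤ C * Real.exp (dotZ (Λ.indicator fun _ => t) x))
    (hphi : ∀ i ∉ Λ, phiE μ (t • ((Λ.indicator fun _ => (1 : ℝ)) - Pi.single i 1)) ≤ 1)
    {x : Fin d → ℤ} (hx : x ∈ posAll) :
    exitExpE μ posAll (posDom Λ) F x ≤ expBarrier Λ C t x := by
  refine exitExpE_le hnn hsum (fun y _ => ?_) hx
  refine le_trans ?_ (tsum_mul_expBarrier_le hC hnn hphi y)
  rw [exitReward, ← ENNReal.tsum_add]
  refine ENNReal.tsum_le_tsum fun z => ?_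
  by_cases hz : z ∈ posAll
  · simp [hz]
  · by_cases hzΛ : z ∈ posDom Λ
    · simp only [hz, hzΛ, not_false_eq_true, and_self, if_true, if_false, add_zero]
      rw [ENNReal.ofReal_mul (hnn _)]
      gcongr
      exact ofReal_le_expBarrier hC ht hF hzΛ hz
    · simp [hz, hzΛ]

/-- Directions in which the moment generating function decreases. -/
lemma exists_pos_phiE_le_one (hnn : ∀ z, 0 ≤ μ z) (hsum : HasSum μ 1) (hA2 : A2 μ)
    (hM : ∀ i, 0 ≤ Mvec μ i) :
    ∃ t : ℝ, 0 < t ∧ ∀ i ∉ LambdaM μ,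
      phiE μ (t • (((LambdaM μ).indicator fun _ => (1 : ℝ)) - Pi.single i 1)) ≤ 1 := by
  have h : ∀ᶠ t : ℝ in 𝓝[>] 0, ∀ i, i ∉ LambdaM μ →
      phiE μ (t • (((LambdaM μ).indicator fun _ => (1 : ℝ)) - Pi.single i 1)) ≤ 1 := by
    refine eventually_all.mpr fun i => ?_
    by_cases hi : i ∈ LambdaM μ
    · exact Eventually.of_forall fun _ h => absurd hi h
    · refine (eventually_phiE_smul_le_one hnn hsum hA2 ?_).mono fun _ h _ => h
      have h1 : ∑ k, (LambdaM μ).indicator (fun _ => (1 : ℝ)) k * Mvec μ k = 0 := by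
        refine Finset.sum_eq_zero fun k _ => ?_
        by_cases hk : k ∈ LambdaM μ
        · rw [show Mvec μ k = 0 from hk, mul_zero]
        · rw [Set.indicator_of_notMem hk, zero_mul]
      have h2 : ∑ k, (Pi.single i 1 : Fin d → ℝ) k * Mvec μ k = Mvec μ i := by
        rw [Finset.sum_eq_single i (fun k _ hk => by simp [hk]) (by simp)]
        simp
      simp only [dotR, Pi.sub_apply, sub_mul, Finset.sum_sub_distrib]
      rw [h1, h2, zero_sub, neg_lt_zero]
      exact lt_of_le_of_ne (hM i) (Ne.symm hi)
  obtain ⟨t, ht, hpos⟩ := (h.and self_mem_nhdsWithin).exists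
  exact ⟨t, hpos, ht⟩

end Positivity

theorem statement17 {d : ℕ} (μ : (Fin d → ℤ) → ℝ)
    (hnn : ∀ z, 0 ≤ μ z) (hsum : HasSum μ 1)
    (hA1 : A1 μ) (hA2 : A2 μ) (hA3 : A3 μ)
    (hM : ∀ i, 0 ≤ Mvec μ i)
    (f : (↥(LambdaM μ) → ℤ) → ℝ) (hf : ∀ u ∈ posL (LambdaM μ), 0 < f u)
    (hharm : HarmOn (muL μ (LambdaM μ)) (posL (LambdaM μ)) f) :
    -- `h(x) = f(x^Λ) − E_x(f(S^Λ(τ)); τ < τ_Λ)` is finite, strictly positive and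
    -- harmonic for the killed walk `Z`
    (∀ x ∈ posAll,
      exitExpE μ posAll (posDom (LambdaM μ)) (fun y => f (projL (LambdaM μ) y)) x ≠ ⊤ ∧
      0 < f (projL (LambdaM μ) x) -
          (exitExpE μ posAll (posDom (LambdaM μ)) (fun y => f (projL (LambdaM μ) y)) x).toReal) ∧
    HarmOn μ posAll (fun x =>
      f (projL (LambdaM μ) x) -
        (exitExpE μ posAll (posDom (LambdaM μ)) (fun y => f (projL (LambdaM μ) y)) x).toReal) := by
  have hAB := posAll_subset_posDom (LambdaM μ)
  have hmem {x : Fin d → ℤ} (hx : x ∈ posDom (LambdaM μ)) :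
      projL (LambdaM μ) x ∈ posL (LambdaM μ) := fun i => hx i i.2
  set F : (Fin d → ℤ) → ℝ := fun y => f (projL (LambdaM μ) y)
  have hF : ∀ x ∈ posDom (LambdaM μ), 0 < F x := fun x hx => hf _ (hmem hx)
  have hE : ∀ x ∈ posDom (LambdaM μ), ENNReal.ofReal (F x) = ∑' y,
      if y ∈ posDom (LambdaM μ) then ENNReal.ofReal (μ (y - x)) * ENNReal.ofReal (F y) else 0 :=
    fun x hx => ofReal_comp_projL_eq hnn hsum hf hharm hx
  have hFΛ (x y : Fin d → ℤ) (h : ∀ i ∈ LambdaM μ, x i = y i) : F x = F y :=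
    congrArg f (funext fun i => h i i.2)
  obtain ⟨t, ht, hphi⟩ := exists_pos_phiE_le_one hnn hsum hA2 hM
  obtain ⟨C, hC, hFC⟩ := exists_le_exp_dotZ hnn hsum hA1 hA2 (Λ := LambdaM μ) (fun _ hi => hi)
    hF hFΛ (fun x hx Z hZ => sum_mul_le_of_ofReal_eq hnn hF hx (hE x hx) hZ) ht
  obtain ⟨x₀, hx₀, hx₀Λ, hlt⟩ := exists_expBarrier_lt (Λ := LambdaM μ) (C := C) ht
    (ENNReal.ofReal_pos.mpr (hF (fun _ => 1) fun _ _ => one_pos))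
  rw [← hFΛ x₀ _ hx₀Λ] at hlt
  have hirr : Irred μ (posAll : Set (Fin d → ℤ)) := by
    simpa [posDom, posAll] using hA1 Set.univ
  refine ⟨fun x hx => ⟨ne_top_of_le_ne_top ENNReal.ofReal_ne_top
    (exitExpE_le_ofReal hnn hsum hAB hE hx), sub_pos.mpr ?_⟩, fun x hx => ?_⟩
  · exact toReal_exitExpE_lt hnn hsum hirr hAB hF hE hx₀
      ((exitExpE_le_expBarrier hnn hsum hC.le ht.le hFC hphi hx₀).trans_lt hlt) hx
  · exact (hasSum_mul_sub_exitExpE hnn hsum hAB hF hE hx).tsum_eq.symm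
end

section
/- Let ν be a probability measure on ℤ satisfying (B1)-(B3). Then the convergence norm of the substochastic kernel P_+ equals 1, i.e. ρ(P_+) = 1, and the positive harmonic functions of P_+ are exactly the constant multiples of the function f(k) = k − E_k(ξ(T)), k ∈ ℤ_+. -/
open Filter Topology

attribute [local instance] Classical.propDecidable

/-- `f(k) = k − E_k(ξ(T))`, `T` the first time the walk becomes `≤ 0`. -/
noncomputable def fDoney (ν : ℤ → ℝ) (k : ℤ) : ℝ :=
  (k : ℝ) - exitExp ν {j : ℤ | 0 < j} Set.univ (fun j => (j : ℝ)) k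


/-- A centered irreducible step distribution on `ℤ` with exponential moments of order `2 * θ`. -/
structure CenteredStep (ν : ℤ → ℝ) (θ : ℝ) : Prop where
  nonneg : ∀ k, 0 ≤ ν k
  hasSum : HasSum ν 1
  irred : Irred ν {k : ℤ | 0 < k}
  mean : HasSum (fun k : ℤ => ν k * (k : ℝ)) 0
  pos : 0 < θ
  exp : Summable fun k : ℤ => ν k * Real.exp (2 * θ * |(k : ℝ)|)

/-- The transition operator of the walk killed when it becomes nonpositive. -/
noncomputable def posOp (ν : ℤ → ℝ) (F : ℤ → ℝ) (x : ℤ) : ℝ :=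
  ∑' y : ℤ, ν (y - x) * (Set.Ioi (0 : ℤ)).indicator F y

/-- `posOp ν F` is given by summable series. -/
def PosSummable (ν : ℤ → ℝ) (F : ℤ → ℝ) : Prop :=
  ∀ x : ℤ, 0 < x → Summable fun y : ℤ => ν (y - x) * (Set.Ioi (0 : ℤ)).indicator F y

lemma PosSummable.add {ν F G : ℤ → ℝ} (hF : PosSummable ν F) (hG : PosSummable ν G) :
    PosSummable ν (F + G) := fun x hx => by
  simpa only [Set.indicator_add', Pi.add_apply, mul_add] using (hF x hx).add (hG x hx)

lemma PosSummable.sub {ν F G : ℤ → ℝ} (hF : PosSummable ν F) (hG : PosSummable ν G) :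
    PosSummable ν (F - G) := fun x hx => by
  simpa only [Set.indicator_sub', Pi.sub_apply, mul_sub] using (hF x hx).sub (hG x hx)

lemma PosSummable.smul {ν F : ℤ → ℝ} (c : ℝ) (hF : PosSummable ν F) :
    PosSummable ν (c • F) := fun x hx => by
  have := (hF x hx).mul_left c
  refine this.congr fun y => ?_
  simp [Set.indicator, mul_left_comm]

lemma posOp_add {ν F G : ℤ → ℝ} (hF : PosSummable ν F) (hG : PosSummable ν G) {x : ℤ}
    (hx : 0 < x) : posOp ν (F + G) x = posOp ν F x + posOp ν G x := by
  simp only [posOp, Set.indicator_add', Pi.add_apply, mul_add]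
  exact (hF x hx).tsum_add (hG x hx)

lemma posOp_sub {ν F G : ℤ → ℝ} (hF : PosSummable ν F) (hG : PosSummable ν G) {x : ℤ}
    (hx : 0 < x) : posOp ν (F - G) x = posOp ν F x - posOp ν G x := by
  simp only [posOp, Set.indicator_sub', Pi.sub_apply, mul_sub]
  exact (hF x hx).tsum_sub (hG x hx)

lemma posOp_smul {ν : ℤ → ℝ} (c : ℝ) (F : ℤ → ℝ) (x : ℤ) :
    posOp ν (c • F) x = c * posOp ν F x := by
  simp only [posOp, ← tsum_mul_left]
  refine tsum_congr fun y => ?_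
  simp [Set.indicator, mul_left_comm]

lemma harmOn_iff {ν h : ℤ → ℝ} :
    HarmOn ν {k : ℤ | 0 < k} h ↔ ∀ x : ℤ, 0 < x → h x = posOp ν h x := by
  refine forall₂_congr fun x _ => ?_
  refine Eq.congr_right (tsum_congr fun y => ?_)
  by_cases hy : 0 < y <;> simp [hy]

namespace CenteredStep

variable {ν : ℤ → ℝ} {θ : ℝ}

lemma hasSum_shift {F : ℤ → ℝ} {s : ℝ} (x : ℤ) (h : HasSum (fun k => ν k * F (k + x)) s) :
    HasSum (fun y => ν (y - x) * F y) s := by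
  have := (Equiv.subRight x).hasSum_iff (f := fun k => ν k * F (k + x)) (a := s)
  simpa [Function.comp_def] using this.2 h

lemma hasSum_one (hν : CenteredStep ν θ) (x : ℤ) : HasSum (fun y => ν (y - x) * 1) 1 :=
  hasSum_shift (F := fun _ => 1) x (by simpa using hν.hasSum)

lemma hasSum_id (hν : CenteredStep ν θ) (x : ℤ) :
    HasSum (fun y : ℤ => ν (y - x) * (y : ℝ)) x := by
  refine hasSum_shift (F := fun y : ℤ => (y : ℝ)) x ?_
  have := hν.mean.add (hν.hasSum.mul_right (x : ℝ))
  simpa [mul_add] using this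

lemma summable_exp (hν : CenteredStep ν θ) {s : ℝ} (hs : |s| ≤ 2 * θ) :
    Summable fun k : ℤ => ν k * Real.exp (s * k) := by
  refine hν.exp.of_nonneg_of_le (fun k => mul_nonneg (hν.nonneg k) (Real.exp_pos _).le)
    fun k => mul_le_mul_of_nonneg_left (Real.exp_le_exp.2 ?_) (hν.nonneg k)
  calc s * k ≤ |s * k| := le_abs_self _
    _ = |s| * |(k : ℝ)| := abs_mul _ _
    _ ≤ _ := mul_le_mul_of_nonneg_right hs (abs_nonneg _)

/-- The moment generating function of the step distribution. -/
noncomputable def mgf (ν : ℤ → ℝ) (s : ℝ) : ℝ := ∑' k : ℤ, ν k * Real.exp (s * k)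

lemma hasSum_exp (hν : CenteredStep ν θ) {s : ℝ} (hs : |s| ≤ 2 * θ) (a : ℝ) (x : ℤ) :
    HasSum (fun y : ℤ => ν (y - x) * Real.exp (s * (y - a)))
      (Real.exp (s * (x - a)) * mgf ν s) := by
  refine hasSum_shift (F := fun y : ℤ => Real.exp (s * (y - a))) x ?_
  have := (hν.summable_exp hs).hasSum.mul_left (Real.exp (s * (x - a)))
  refine this.congr_fun ?_
  intro k
  rw [mul_left_comm, ← Real.exp_add]
  push_cast
  ring_nf

/-- The induction principle along positive paths. -/
lemma path_induction (hν : CenteredStep ν θ) {S : ℤ → Prop} {b : ℤ} (hb : 0 < b) (hSb : S b)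
    (hS : ∀ x y : ℤ, 0 < x → 0 < y → 0 < ν (y - x) → S y → S x) {a : ℤ} (ha : 0 < a) : S a := by
  obtain ⟨k, c, h0, hk, hpos, hstep⟩ := hν.irred a ha b hb
  have key : ∀ i ≤ k, S (c (k - i)) := by
    intro i
    induction i with
    | zero => intro _; simpa [hk] using hSb
    | succ i ih =>
      intro hi
      refine hS _ (c (k - i)) (hpos _ (by omega)) (hpos _ (by omega)) ?_ (ih (by omega))
      have := hstep (k - (i + 1)) (by omega)
      rwa [show k - (i + 1) + 1 = k - i by omega] at this
  simpa [h0] using key k le_rfl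

lemma exists_neg (hν : CenteredStep ν θ) : ∃ j < 0, 0 < ν j := by
  by_contra! hcon
  have h0 : ∀ j < 0, ν j = 0 := fun j hj => le_antisymm (hcon j hj) (hν.nonneg j)
  have hterm : ∀ k : ℤ, 0 ≤ ν k * (k : ℝ) := fun k => by
    rcases lt_or_ge k 0 with hk | hk
    · simp [h0 k hk]
    · exact mul_nonneg (hν.nonneg k) (by exact_mod_cast hk)
  have hz := (hasSum_zero_iff_of_nonneg hterm).1 hν.mean
  have h1 : ∀ k : ℤ, 0 < ν k → k = 0 := fun k hk => by
    have := congrFun hz k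
    simpa [hk.ne'] using this
  have := hν.path_induction (S := fun x => x = 2) (b := 2) (by norm_num) rfl
    (fun x y _ _ hxy hy => by have := h1 _ hxy; omega) (a := 1) one_pos
  omega

lemma one_lt_mgf (hν : CenteredStep ν θ) {s : ℝ} (hs : |s| ≤ 2 * θ) (hs0 : s ≠ 0) :
    1 < mgf ν s := by
  have h := ((hν.summable_exp hs).hasSum.sub hν.hasSum).sub (hν.mean.mul_left s)
  have hterm : ∀ k : ℤ, 0 ≤ ν k * Real.exp (s * k) - ν k - s * (ν k * k) := fun k => by
    have := mul_le_mul_of_nonneg_left (Real.add_one_le_exp (s * k)) (hν.nonneg k)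
    nlinarith
  obtain ⟨j, hj, hνj⟩ := hν.exists_neg
  have hlt : 0 < ν j * Real.exp (s * j) - ν j - s * (ν j * j) := by
    have hj' : (j : ℝ) ≠ 0 := by exact_mod_cast hj.ne
    have := mul_lt_mul_of_pos_left (Real.add_one_lt_exp (mul_ne_zero hs0 hj')) hνj
    nlinarith
  have := lt_of_lt_of_le hlt (le_hasSum h j fun i _ => hterm i)
  change 0 < mgf ν s - 1 - s * 0 at this
  linarith

lemma mgf_nonneg (hν : CenteredStep ν θ) (s : ℝ) : 0 ≤ mgf ν s :=
  tsum_nonneg fun k => mul_nonneg (hν.nonneg k) (Real.exp_pos _).le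

lemma posSummable_of_le (hν : CenteredStep ν θ) {F : ℤ → ℝ} {C : ℝ}
    (hF : ∀ y : ℤ, 0 < y → |F y| ≤ C * Real.exp (2 * θ * y)) : PosSummable ν F := fun x _ => by
  have hθ := hν.pos
  have h :=
    (hν.hasSum_exp (s := 2 * θ) (by rw [abs_of_pos (by linarith)]) 0 x).summable.mul_left |C|
  refine Summable.of_norm_bounded h fun y => ?_
  rw [norm_mul, Real.norm_of_nonneg (hν.nonneg _), mul_left_comm]
  refine mul_le_mul_of_nonneg_left ?_ (hν.nonneg _)
  by_cases hy : 0 < y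
  · rw [Set.indicator_of_mem (Set.mem_Ioi.2 hy), Real.norm_eq_abs, sub_zero]
    exact (hF y hy).trans (mul_le_mul_of_nonneg_right (le_abs_self C) (Real.exp_pos _).le)
  · rw [Set.indicator_of_notMem (by simpa using hy), norm_zero]
    positivity

lemma posSummable_of_bounded (hν : CenteredStep ν θ) {F : ℤ → ℝ} {C : ℝ}
    (hF : ∀ y : ℤ, 0 < y → |F y| ≤ C) : PosSummable ν F := by
  refine hν.posSummable_of_le (C := C) fun y hy => (hF y hy).trans ?_
  have hC : 0 ≤ C := (abs_nonneg _).trans (hF y hy)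
  have hy' : (0 : ℝ) < y := by exact_mod_cast hy
  have := hν.pos
  exact le_mul_of_one_le_right hC (Real.one_le_exp (by positivity))

lemma posSummable_id (hν : CenteredStep ν θ) : PosSummable ν fun y : ℤ => (y : ℝ) := by
  have := hν.pos
  refine hν.posSummable_of_le (C := (2 * θ)⁻¹) fun y hy => ?_
  have hy' : (0 : ℝ) < y := by exact_mod_cast hy
  rw [abs_of_pos hy', inv_mul_eq_div, le_div_iff₀ (by positivity)]
  nlinarith [Real.add_one_le_exp (2 * θ * y)]

lemma posOp_mono (hν : CenteredStep ν θ) {F G : ℤ → ℝ} (hF : PosSummable ν F)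
    (hG : PosSummable ν G) (h : ∀ y : ℤ, 0 < y → F y ≤ G y) {x : ℤ} (hx : 0 < x) :
    posOp ν F x ≤ posOp ν G x :=
  (hF x hx).tsum_le_tsum (fun y => mul_le_mul_of_nonneg_left
    (Set.indicator_le_indicator' fun hy => h y hy) (hν.nonneg _)) (hG x hx)

lemma posOp_nonneg (hν : CenteredStep ν θ) {F : ℤ → ℝ} (h : ∀ y : ℤ, 0 < y → 0 ≤ F y) (x : ℤ) :
    0 ≤ posOp ν F x :=
  tsum_nonneg fun y => mul_nonneg (hν.nonneg _) (Set.indicator_nonneg (fun y hy => h y hy) y)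

lemma posOp_le_of_hasSum (hν : CenteredStep ν θ) {F G : ℤ → ℝ} {s : ℝ} {x : ℤ} (hx : 0 < x)
    (hF : PosSummable ν F) (hG : HasSum (fun y => ν (y - x) * G y) s)
    (h : ∀ y : ℤ, 0 < y → F y ≤ G y) (h0 : ∀ y : ℤ, y ≤ 0 → 0 ≤ G y) : posOp ν F x ≤ s := by
  refine hasSum_le (fun y => mul_le_mul_of_nonneg_left ?_ (hν.nonneg _)) (hF x hx).hasSum hG
  by_cases hy : 0 < y
  · simpa [hy] using h y hy
  · simpa [hy] using h0 y (not_lt.1 hy)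

lemma le_posOp_of_hasSum (hν : CenteredStep ν θ) {F G : ℤ → ℝ} {s : ℝ} {x : ℤ} (hx : 0 < x)
    (hF : PosSummable ν F) (hG : HasSum (fun y => ν (y - x) * G y) s)
    (h : ∀ y : ℤ, 0 < y → G y ≤ F y) (h0 : ∀ y : ℤ, y ≤ 0 → G y ≤ 0) : s ≤ posOp ν F x := by
  refine hasSum_le (fun y => mul_le_mul_of_nonneg_left ?_ (hν.nonneg _)) hG (hF x hx).hasSum
  by_cases hy : 0 < y
  · simpa [hy] using h y hy
  · simpa [hy] using h0 y (not_lt.1 hy)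

lemma mul_le_posOp (hν : CenteredStep ν θ) {F : ℤ → ℝ} (hF : PosSummable ν F)
    (h : ∀ y : ℤ, 0 < y → 0 ≤ F y) {x : ℤ} (hx : 0 < x)
    {y : ℤ} (hy : 0 < y) :
    ν (y - x) * F y ≤ posOp ν F x := by
  have := (hF x hx).le_tsum y fun z _ =>
    mul_nonneg (hν.nonneg _) (Set.indicator_nonneg (fun y hy => h y hy) z)
  simpa [hy, posOp] using this

/-- The maximum principle on finite sets. -/
lemma nonpos_of_lt_posOp (hν : CenteredStep ν θ) {u : ℤ → ℝ} (hu : PosSummable ν u)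
    (D : Finset ℤ) (hD0 : ∀ z ∈ D, 0 < z)
    (hD : ∀ z ∈ D, u z < posOp ν u z) (hout : ∀ z : ℤ, 0 < z → z ∉ D → u z ≤ 0) :
    ∀ z ∈ D, u z ≤ 0 := by
  by_contra! hcon
  obtain ⟨z₁, hz₁, hpos⟩ := hcon
  obtain ⟨z₀, hz₀, hmax⟩ := D.exists_max_image u ⟨z₁, hz₁⟩
  have hm : 0 < u z₀ := hpos.trans_le (hmax z₁ hz₁)
  refine (hD z₀ hz₀).not_ge (hν.posOp_le_of_hasSum (G := fun _ => u z₀) (hD0 z₀ hz₀) hu ?_ ?_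
    fun _ _ => hm.le)
  · simpa using (hν.hasSum_one z₀).mul_right (u z₀)
  · intro y hy
    by_cases hyD : y ∈ D
    · exact hmax y hyD
    · exact (hout y hy hyD).trans hm.le

/-- Harmonic functions are given by summable series. -/
lemma _root_.posSummable_of_harmonic {h : ℤ → ℝ} (hpos : ∀ k : ℤ, 0 < k → 0 < h k)
    (hh : ∀ x : ℤ, 0 < x → h x = posOp ν h x) :
    PosSummable ν h := by
  intro x hx
  by_contra hs
  have := hh x hx
  rw [posOp, tsum_eq_zero_of_not_summable hs] at this
  exact (hpos x hx).ne' this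

lemma exists_mgf_bounds (hν : CenteredStep ν θ) : ∃ c M : ℝ, 0 < c ∧ 0 ≤ M ∧ 1 + c ≤ mgf ν θ ∧
    1 + c ≤ mgf ν (-θ) ∧ mgf ν (2 * θ) ≤ M ∧ mgf ν (-(2 * θ)) ≤ M := by
  have hθ := hν.pos
  have h1 := hν.one_lt_mgf (s := θ) (by rw [abs_of_pos hθ]; linarith) hθ.ne'
  have h2 := hν.one_lt_mgf (s := -θ) (by rw [abs_neg, abs_of_pos hθ]; linarith)
    (neg_ne_zero.2 hθ.ne')
  refine ⟨min (mgf ν θ - 1) (mgf ν (-θ) - 1), max (mgf ν (2 * θ)) (mgf ν (-(2 * θ))),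
    lt_min (by linarith) (by linarith), (hν.mgf_nonneg _).trans (le_max_left _ _), ?_, ?_,
    le_max_left _ _, le_max_right _ _⟩
  · linarith [min_le_left (mgf ν θ - 1) (mgf ν (-θ) - 1)]
  · linarith [min_le_right (mgf ν θ - 1) (mgf ν (-θ) - 1)]

lemma exists_shift_harnack (hν : CenteredStep ν θ) {h : ℤ → ℝ} (hpos : ∀ k : ℤ, 0 < k → 0 < h k)
    (hh : ∀ x : ℤ, 0 < x → h x = posOp ν h x) {a b : ℤ} (ha : 0 < a) (hb : 0 < b) :
    ∃ κ : ℝ, 0 < κ ∧ ∀ s : ℤ, 0 ≤ s → κ * h (b + s) ≤ h (a + s) := by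
  refine hν.path_induction (S := fun a => ∃ κ : ℝ, 0 < κ ∧ ∀ s : ℤ, 0 ≤ s →
    κ * h (b + s) ≤ h (a + s)) hb ⟨1, one_pos, fun s _ => by simp⟩ ?_ ha
  rintro x y hx hy hxy ⟨κ, hκ, H⟩
  refine ⟨ν (y - x) * κ, mul_pos hxy hκ, fun s hs => ?_⟩
  have := hν.mul_le_posOp (posSummable_of_harmonic hpos hh) (fun k hk => (hpos k hk).le)
    (x := x + s) (by omega) (y := y + s) (by omega)
  rw [← hh _ (by omega), show y + s - (x + s) = y - x by ring] at this
  rw [mul_assoc]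
  exact (mul_le_mul_of_nonneg_left (H s hs) hxy.le).trans this

/-- The Harnack inequality, uniform under translations. -/
lemma exists_harnack (hν : CenteredStep ν θ) {h : ℤ → ℝ} (hpos : ∀ k : ℤ, 0 < k → 0 < h k)
    (hh : ∀ x : ℤ, 0 < x → h x = posOp ν h x) (r : ℕ) :
    ∃ κ : ℝ, 0 < κ ∧ ∀ x y : ℤ, 0 < x → 0 < y → |x - y| ≤ r → κ * h x ≤ h y := by
  obtain ⟨κ₁, hκ₁, h₁⟩ := hν.exists_shift_harnack hpos hh (a := 1) (b := 2) (by norm_num)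
    (by norm_num)
  obtain ⟨κ₂, hκ₂, h₂⟩ := hν.exists_shift_harnack hpos hh (a := 2) (b := 1) (by norm_num)
    (by norm_num)
  induction r with
  | zero =>
    refine ⟨1, one_pos, fun x y _ _ hxy => ?_⟩
    obtain rfl : x = y := by
      rw [abs_le] at hxy
      push_cast at hxy
      omega
    simp
  | succ r ih =>
    obtain ⟨κ, hκ, H⟩ := ih
    refine ⟨κ * min 1 (min κ₁ κ₂), by positivity, fun x y hx hy hxy => ?_⟩
    have hstep : ∃ y' : ℤ, 0 < y' ∧ |x - y'| ≤ r ∧ min 1 (min κ₁ κ₂) * h y' ≤ h y := by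
      rw [abs_le] at hxy
      push_cast at hxy
      rcases lt_trichotomy x y with hlt | rfl | hlt
      · refine ⟨y - 1, by omega, by rw [abs_le]; omega, ?_⟩
        have := h₂ (y - 2) (by omega)
        rw [show 1 + (y - 2) = y - 1 by ring, show 2 + (y - 2) = y by ring] at this
        exact (mul_le_mul_of_nonneg_right ((min_le_right _ _).trans (min_le_right _ _))
          (hpos _ (by omega)).le).trans this
      · exact ⟨x, hx, by simp, mul_le_of_le_one_left (hpos x hx).le (min_le_left _ _)⟩
      · refine ⟨y + 1, by omega, by rw [abs_le]; omega, ?_⟩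
        have := h₁ (y - 1) (by omega)
        rw [show 2 + (y - 1) = y + 1 by ring, show 1 + (y - 1) = y by ring] at this
        exact (mul_le_mul_of_nonneg_right ((min_le_right _ _).trans (min_le_left _ _))
          (hpos _ (by omega)).le).trans this
    obtain ⟨y', hy', hxy', hle⟩ := hstep
    calc κ * min 1 (min κ₁ κ₂) * h x = min 1 (min κ₁ κ₂) * (κ * h x) := by ring
      _ ≤ min 1 (min κ₁ κ₂) * h y' :=
        mul_le_mul_of_nonneg_left (H x y' hx hy' hxy') (by positivity)
      _ ≤ h y := hle

/-- The probability that the killed walk survives `n` steps. -/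
noncomputable def survival (ν : ℤ → ℝ) : ℕ → ℤ → ℝ
  | 0 => fun _ => 1
  | n + 1 => posOp ν (survival ν n)

lemma survival_nonneg (hν : CenteredStep ν θ) (n : ℕ) (z : ℤ) : 0 ≤ survival ν n z := by
  induction n generalizing z with
  | zero => exact zero_le_one
  | succ n ih => exact hν.posOp_nonneg (fun y _ => ih y) z

lemma survival_le_one (hν : CenteredStep ν θ) (n : ℕ) {z : ℤ} (hz : 0 < z) :
    survival ν n z ≤ 1 := by
  induction n generalizing z with
  | zero => exact le_rfl
  | succ n ih =>
    refine hν.posOp_le_of_hasSum hz (hν.posSummable_of_bounded (C := 1) fun y hy => ?_)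
      (hν.hasSum_one z) (fun y hy => ih hy) fun _ _ => zero_le_one
    rw [abs_of_nonneg (hν.survival_nonneg n y)]
    exact ih hy

lemma posSummable_survival (hν : CenteredStep ν θ) (n : ℕ) : PosSummable ν (survival ν n) :=
  hν.posSummable_of_bounded (C := 1) fun y hy => by
    rw [abs_of_nonneg (hν.survival_nonneg n y)]
    exact hν.survival_le_one n hy

lemma survival_succ_le (hν : CenteredStep ν θ) (n : ℕ) {z : ℤ} (hz : 0 < z) :
    survival ν (n + 1) z ≤ survival ν n z := by
  induction n generalizing z with
  | zero => exact hν.survival_le_one 1 hz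
  | succ n ih =>
    exact hν.posOp_mono (hν.posSummable_survival _) (hν.posSummable_survival _)
      (fun y hy => ih hy) hz

lemma survival_anti (hν : CenteredStep ν θ) {m n : ℕ} (hmn : m ≤ n) {z : ℤ} (hz : 0 < z) :
    survival ν n z ≤ survival ν m z :=
  antitone_nat_of_succ_le (f := fun n => survival ν n z) (fun n => hν.survival_succ_le n hz) hmn

lemma posOp_lt_one_of_lt (hν : CenteredStep ν θ) {F : ℤ → ℝ} (hF : PosSummable ν F)
    (h1 : ∀ y : ℤ, 0 < y → F y ≤ 1) {x y : ℤ} (hx : 0 < x) (hxy : 0 < ν (y - x))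
    (hy : (Set.Ioi (0 : ℤ)).indicator F y < 1) : posOp ν F x < 1 := by
  have h := (hν.hasSum_one x).sub (hF x hx).hasSum
  have hle : ∀ z : ℤ, (Set.Ioi (0 : ℤ)).indicator F z ≤ 1 := fun z =>
    Set.indicator_apply_le' (fun hz => h1 z hz) fun _ => zero_le_one
  have := le_hasSum h y fun z _ => by
    rw [← mul_sub]
    exact mul_nonneg (hν.nonneg _) (sub_nonneg.2 (hle z))
  rw [← mul_sub] at this
  have := (mul_pos hxy (sub_pos.2 hy)).trans_le this
  exact sub_pos.1 this

lemma exists_survival_lt_one (hν : CenteredStep ν θ) {z : ℤ} (hz : 0 < z) :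
    ∃ n, survival ν n z < 1 := by
  refine hν.path_induction (S := fun z => ∃ n, survival ν n z < 1) (b := 1)
    one_pos ⟨1, ?_⟩ ?_ hz
  · obtain ⟨j, hj, hνj⟩ := hν.exists_neg
    refine hν.posOp_lt_one_of_lt (hν.posSummable_survival 0) (fun _ _ => le_rfl) one_pos
      (y := 1 + j) (by simpa using hνj) ?_
    rw [Set.indicator_of_notMem (by rw [Set.mem_Ioi]; omega)]
    exact zero_lt_one
  · rintro x y hx hy hxy ⟨n, hn⟩
    refine ⟨n + 1, hν.posOp_lt_one_of_lt (hν.posSummable_survival n)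
      (fun z hz => hν.survival_le_one n hz) hx hxy ?_⟩
    rwa [Set.indicator_of_mem (Set.mem_Ioi.2 hy)]

lemma exists_uniform_survival (hν : CenteredStep ν θ) (N : ℕ) :
    ∃ m : ℕ, ∃ η : ℝ, 0 < η ∧ ∀ z : ℤ, 0 < z → z ≤ N → survival ν m z ≤ 1 - η := by
  induction N with
  | zero => exact ⟨0, 1, one_pos, fun z hz hz' => by simp at hz'; omega⟩
  | succ N ih =>
    obtain ⟨m, η, hη, H⟩ := ih
    obtain ⟨n, hn⟩ := hν.exists_survival_lt_one (z := N + 1) (by omega)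
    refine ⟨max m n, min η (1 - survival ν n (N + 1)), lt_min hη (by linarith), fun z hz hz' => ?_⟩
    rcases le_or_gt z N with h | h
    · have := hν.survival_anti (le_max_left m n) hz
      have := H z hz h
      linarith [min_le_left η (1 - survival ν n (N + 1))]
    · obtain rfl : z = N + 1 := by push_cast at hz'; omega
      have := hν.survival_anti (le_max_right m n) hz
      linarith [min_le_right η (1 - survival ν n (N + 1))]

lemma posOp_sum_survival (hν : CenteredStep ν θ) (m : ℕ) :
    PosSummable ν (∑ j ∈ Finset.range m, survival ν j) ∧ ∀ z : ℤ, 0 < z →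
    posOp ν (∑ j ∈ Finset.range m, survival ν j) z =
      ∑ j ∈ Finset.range m, survival ν (j + 1) z := by
  induction m with
  | zero => exact ⟨by intro x _; simp [summable_zero], fun z _ => by simp [posOp]⟩
  | succ m ih =>
    rw [Finset.sum_range_succ]
    refine ⟨ih.1.add (hν.posSummable_survival m), fun z hz => ?_⟩
    rw [posOp_add ih.1 (hν.posSummable_survival m) hz, ih.2 z hz, Finset.sum_range_succ]
    rfl

/-- A bounded supersolution which is strict near the origin. -/
lemma exists_supersolution_near_zero (hν : CenteredStep ν θ) (N : ℕ) :
    ∃ (E : ℤ → ℝ) (C η : ℝ), 0 < η ∧ (∀ z : ℤ, 0 < z → 0 ≤ E z ∧ E z ≤ C) ∧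
      (∀ z : ℤ, 0 < z → posOp ν E z ≤ E z) ∧ ∀ z : ℤ, 0 < z → z ≤ N → posOp ν E z ≤ E z - η := by
  obtain ⟨m, η, hη, H⟩ := hν.exists_uniform_survival N
  have key : ∀ z : ℤ, 0 < z → posOp ν (∑ j ∈ Finset.range m, survival ν j) z =
      (∑ j ∈ Finset.range m, survival ν j) z - (1 - survival ν m z) := fun z hz => by
    rw [(hν.posOp_sum_survival m).2 z hz, Finset.sum_apply]
    have h1 := Finset.sum_range_succ (fun j => survival ν j z) m
    have h2 := Finset.sum_range_succ' (fun j => survival ν j z) m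
    have h3 : survival ν 0 z = 1 := rfl
    linarith
  refine ⟨∑ j ∈ Finset.range m, survival ν j, m, η, hη, fun z hz => ⟨?_, ?_⟩, fun z hz => ?_,
    fun z hz hzN => ?_⟩
  · rw [Finset.sum_apply]
    exact Finset.sum_nonneg fun j _ => hν.survival_nonneg j z
  · rw [Finset.sum_apply]
    simpa using Finset.sum_le_sum (s := Finset.range m) fun j _ => hν.survival_le_one j hz
  · rw [key z hz]
    linarith [hν.survival_le_one m hz]
  · rw [key z hz]
    linarith [H z hz hzN]

lemma exists_nat_mul_exp_lt (hν : CenteredStep ν θ) (M : ℝ) {c : ℝ} (hc : 0 < c) :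
    ∃ r : ℕ, ∀ t : ℝ, r ≤ t → M * Real.exp (-θ * t) < c := by
  have hθ := hν.pos
  obtain ⟨r, hr⟩ := exists_nat_gt (M / (c * θ))
  refine ⟨r, fun t ht => ?_⟩
  have h1 : M < t * (c * θ) := (div_lt_iff₀ (by positivity)).1 (hr.trans_le ht)
  have h2 := Real.add_one_le_exp (θ * t)
  rw [neg_mul, Real.exp_neg, ← div_eq_mul_inv, div_lt_iff₀ (Real.exp_pos _)]
  nlinarith

/-- A strict supersolution which is a bounded nonnegative perturbation of the identity. -/
lemma exists_linear_supersolution (hν : CenteredStep ν θ) :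
    ∃ (Q : ℤ → ℝ) (C : ℝ), (∀ z : ℤ, 0 < z → 0 ≤ Q z ∧ Q z ≤ C) ∧ ∀ z : ℤ, 0 < z →
      posOp ν (fun y => (y : ℝ)) z + posOp ν Q z ≤ z + Q z - Real.exp (-θ * z) := by
  have hθ := hν.pos
  obtain ⟨c, M, hc, hM, -, hmgf, -, hmgf2⟩ := hν.exists_mgf_bounds
  have hid : ∀ z : ℤ, 0 < z →
      posOp ν (fun y => (y : ℝ)) z ≤ z + (2 * θ)⁻¹ * (Real.exp (-(2 * θ) * z) * M) := by
    intro z hz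
    have hs := (hν.hasSum_id z).add ((hν.hasSum_exp (s := -(2 * θ))
      (by rw [abs_neg, abs_of_pos (by positivity)]) 0 z).mul_left (2 * θ)⁻¹)
    simp only [sub_zero] at hs
    refine (hν.posOp_le_of_hasSum hz hν.posSummable_id
      (G := fun y => y + (2 * θ)⁻¹ * Real.exp (-(2 * θ) * y))
      (hs.congr_fun fun y => by ring) (fun y _ => ?_) fun y hy => ?_).trans ?_
    · have : 0 ≤ (2 * θ)⁻¹ * Real.exp (-(2 * θ) * y) := by positivity
      linarith
    · have := Real.add_one_le_exp (-(2 * θ) * y)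
      have h2 : -(y : ℝ) ≤ (2 * θ)⁻¹ * Real.exp (-(2 * θ) * y) := by
        rw [inv_mul_eq_div, le_div_iff₀ (by positivity)]
        linarith
      linarith
    · gcongr
  have hg_sum : PosSummable ν fun y : ℤ => 1 - Real.exp (-θ * y) := by
    refine hν.posSummable_of_bounded (C := 1) fun y hy => ?_
    have hy' : (0 : ℝ) < y := by exact_mod_cast hy
    have h1 : Real.exp (-θ * y) ≤ 1 := Real.exp_le_one_iff.2 (by nlinarith)
    rw [abs_le]
    constructor <;> linarith [Real.exp_pos (-θ * y)]
  have hg : ∀ z : ℤ, 0 < z → posOp ν (fun y => 1 - Real.exp (-θ * y)) z ≤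
      1 - Real.exp (-θ * z) * (1 + c) + Real.exp (-(2 * θ) * z) * M := by
    intro z hz
    have hs := ((hν.hasSum_one z).sub (hν.hasSum_exp (s := -θ)
      (by rw [abs_neg, abs_of_pos hθ]; linarith) 0 z)).add (hν.hasSum_exp (s := -(2 * θ))
      (by rw [abs_neg, abs_of_pos (by positivity)]) 0 z)
    simp only [sub_zero] at hs
    refine (hν.posOp_le_of_hasSum hz hg_sum
      (G := fun y => 1 - Real.exp (-θ * y) + Real.exp (-(2 * θ) * y))
      (hs.congr_fun fun y => by ring) (fun y _ => ?_) fun y hy => ?_).trans ?_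
    · linarith [Real.exp_pos (-(2 * θ) * y)]
    · have : Real.exp (-(2 * θ) * y) = Real.exp (-θ * y) ^ 2 := by
        rw [← Real.exp_nat_mul]
        push_cast
        ring_nf
      rw [this]
      nlinarith [sq_nonneg (Real.exp (-θ * y) - 1), Real.exp_pos (-θ * y)]
    · gcongr
  set a := 2 / c with ha
  set K := ((2 * θ)⁻¹ + a) * M with hK
  have ha0 : 0 < a := by positivity
  have hK0 : 0 ≤ K := by positivity
  obtain ⟨N, hN⟩ := hν.exists_nat_mul_exp_lt K one_pos
  obtain ⟨E, C, η, hη, hE, hE1, hE2⟩ := hν.exists_supersolution_near_zero N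
  have hE_sum : PosSummable ν E := hν.posSummable_of_bounded (C := C) fun y hy => by
    rw [abs_of_nonneg (hE y hy).1]
    exact (hE y hy).2
  set b := K / η with hb
  have hb0 : 0 ≤ b := by positivity
  refine ⟨a • (fun y : ℤ => 1 - Real.exp (-θ * y)) + b • E, a + b * C, fun z hz => ?_,
    fun z hz => ?_⟩
  · have hz' : (0 : ℝ) < z := by exact_mod_cast hz
    have h1 : Real.exp (-θ * z) ≤ 1 := Real.exp_le_one_iff.2 (by nlinarith)
    simp only [Pi.add_apply, Pi.smul_apply, smul_eq_mul]
    have h2 := mul_le_mul_of_nonneg_left (hE z hz).2 hb0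
    have h3 := mul_nonneg hb0 (hE z hz).1
    constructor <;> nlinarith [Real.exp_pos (-θ * z)]
  · rw [posOp_add (hg_sum.smul a) (hE_sum.smul b) hz, posOp_smul, posOp_smul]
    simp only [Pi.add_apply, Pi.smul_apply, smul_eq_mul]
    have h1 := hid z hz
    have h2 := mul_le_mul_of_nonneg_left (hg z hz) ha0.le
    have hac : a * c = 2 := by rw [ha]; field_simp
    have hexp : Real.exp (-(2 * θ) * z) = Real.exp (-θ * z) * Real.exp (-θ * z) := by
      rw [← Real.exp_add]
      ring_nf
    have hX := Real.exp_pos (-θ * z)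
    have hX1 : Real.exp (-θ * z) ≤ 1 := Real.exp_le_one_iff.2 (by
      have hz' : (0 : ℝ) < z := by exact_mod_cast hz
      nlinarith)
    rw [hexp] at h1 h2
    set X := Real.exp (-θ * z)
    have hmain : posOp ν (fun y => (y : ℝ)) z + a * posOp ν (fun y => 1 - Real.exp (-θ * y)) z ≤
        z + a * (1 - X) - 2 * X + K * (X * X) := by
      have h3 : a * (1 - X * (1 + c) + X * X * M) = a * (1 - X) - a * c * X + a * M * (X * X) := by
        ring
      rw [hac] at h3
      rw [hK]
      linarith
    rcases le_or_gt z N with hzN | hzN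
    · have h3 := mul_le_mul_of_nonneg_left (hE2 z hz hzN) hb0
      have hbη : b * η = K := by rw [hb]; field_simp
      have h4 : K * (X * X) ≤ K := mul_le_of_le_one_right hK0 (by nlinarith)
      nlinarith
    · have h3 := mul_le_mul_of_nonneg_left (hE1 z hz) hb0
      have h4 := hN z (by exact_mod_cast hzN.le)
      have h5 : K * (X * X) ≤ X := by nlinarith
      linarith

/-- Positive harmonic functions grow at most at an arbitrarily small exponential rate. -/
lemma exists_harmonic_le_exp (hν : CenteredStep ν θ) {h : ℤ → ℝ} (hpos : ∀ k : ℤ, 0 < k → 0 < h k)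
    (hh : ∀ x : ℤ, 0 < x → h x = posOp ν h x) :
    ∃ K : ℝ, 0 < K ∧ ∀ N x : ℤ, 0 < N → N ≤ x → h x ≤ K * Real.exp (θ * (x - N)) * h N := by
  have hθ := hν.pos
  obtain ⟨c, M, hc, hM, hmgf, -, hmgf2, -⟩ := hν.exists_mgf_bounds
  obtain ⟨r, hr⟩ := hν.exists_nat_mul_exp_lt M hc
  obtain ⟨κ, hκ, hharn⟩ := hν.exists_harnack hpos hh r
  have hexp1 : Real.exp (-θ) < 1 := Real.exp_lt_one_iff.2 (by linarith)
  have h1e : 0 < 1 - Real.exp (-θ) := by linarith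
  refine ⟨(κ * (1 - Real.exp (-θ)))⁻¹, by positivity, fun N x hN hNx => ?_⟩
  have hx : 0 < x := hN.trans_le hNx
  have hx' : (0 : ℝ) < x := by exact_mod_cast hx
  have hh_sum := posSummable_of_harmonic hpos hh
  set w : ℤ → ℝ := fun k => if k ≤ x then Real.exp (θ * (k - x)) - Real.exp (-θ * x) else 0 with hw
  have hw_le : ∀ k : ℤ, w k ≤ 1 := fun k => by
    simp only [hw]
    split_ifs with hk
    · have hk' : (k : ℝ) ≤ x := by exact_mod_cast hk
      have : Real.exp (θ * (k - x)) ≤ 1 := Real.exp_le_one_iff.2 (by nlinarith)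
      linarith [Real.exp_pos (-θ * x)]
    · exact zero_le_one
  have hw_nonneg : ∀ k : ℤ, 0 < k → 0 ≤ w k := fun k hk => by
    simp only [hw]
    split_ifs
    · refine sub_nonneg.2 (Real.exp_le_exp.2 ?_)
      have hk' : (0 : ℝ) < k := by exact_mod_cast hk
      nlinarith
    · exact le_rfl
  have hw_sum : PosSummable ν w := hν.posSummable_of_bounded (C := 1) fun y hy => by
    rw [abs_of_nonneg (hw_nonneg y hy)]
    exact hw_le y
  have hw_op : ∀ z : ℤ, 0 < z → z < x - r → w z < posOp ν w z := by
    intro z hz hzx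
    have hs := ((hν.hasSum_exp (s := θ) (by rw [abs_of_pos hθ]; linarith) x z).sub
      ((hν.hasSum_one z).mul_left (Real.exp (-θ * x)))).sub (hν.hasSum_exp (s := 2 * θ)
      (by rw [abs_of_pos (by positivity)]) x z)
    have hle := hν.le_posOp_of_hasSum hz hw_sum (G := fun y => Real.exp (θ * (y - x)) -
      Real.exp (-θ * x) - Real.exp (2 * θ * (y - x))) (hs.congr_fun fun y => by ring)
      (fun y hy => ?_) fun y hy => ?_
    · have hwz : w z = Real.exp (θ * (z - x)) - Real.exp (-θ * x) := by
        simp only [hw]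
        rw [if_pos (by omega)]
      have hzx' : (r : ℝ) ≤ x - z := by
        have : (r : ℤ) ≤ x - z := by omega
        exact_mod_cast this
      have h1 := hr _ hzx'
      rw [show -θ * ((x : ℝ) - z) = θ * (z - x) by ring] at h1
      have h2 : Real.exp (2 * θ * (z - x)) = Real.exp (θ * (z - x)) * Real.exp (θ * (z - x)) := by
        rw [← Real.exp_add]
        ring_nf
      rw [h2] at hle
      have hX := Real.exp_pos (θ * (z - x))
      set X := Real.exp (θ * (z - x))
      have h3 := mul_le_mul_of_nonneg_left hmgf hX.le
      have h4 := mul_le_mul_of_nonneg_left hmgf2 (mul_pos hX hX).le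
      have h5 := mul_lt_mul_of_pos_left h1 hX
      rw [hwz]
      nlinarith
    · simp only [hw]
      split_ifs with hyx
      · linarith [Real.exp_pos (2 * θ * (y - x))]
      · have : (x : ℝ) ≤ y := by exact_mod_cast (not_le.1 hyx).le
        have : Real.exp (θ * (y - x)) ≤ Real.exp (2 * θ * (y - x)) :=
          Real.exp_le_exp.2 (by nlinarith)
        linarith [Real.exp_pos (-θ * x)]
    · have : (y : ℝ) ≤ 0 := by exact_mod_cast hy
      have : Real.exp (θ * (y - x)) ≤ Real.exp (-θ * x) := Real.exp_le_exp.2 (by nlinarith)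
      linarith [Real.exp_pos (2 * θ * (y - x))]
  have hκh : 0 < κ * h x := mul_pos hκ (hpos x hx)
  have hout : ∀ z : ℤ, 0 < z → z ∉ Finset.Ioo 0 (x - r) → ((κ * h x) • w - h) z ≤ 0 := by
    intro z hz hzD
    have hz2 : x - r ≤ z := by simpa [hz] using hzD
    simp only [Pi.sub_apply, Pi.smul_apply, smul_eq_mul]
    rcases le_or_gt z x with hzx | hzx
    · have h1 := hharn x z hx hz (by rw [abs_le]; omega)
      have h2 := mul_le_of_le_one_right hκh.le (hw_le z)
      linarith
    · have : w z = 0 := by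
        simp only [hw]
        rw [if_neg (by omega)]
      rw [this]
      linarith [hpos z hz]
  have hmp := hν.nonpos_of_lt_posOp ((hw_sum.smul (κ * h x)).sub hh_sum) (Finset.Ioo 0 (x - r))
    (fun z hz => (Finset.mem_Ioo.1 hz).1) (fun z hz => by
      obtain ⟨hz, hzx⟩ := Finset.mem_Ioo.1 hz
      rw [posOp_sub (hw_sum.smul _) hh_sum hz, posOp_smul, ← hh z hz]
      simp only [Pi.sub_apply, Pi.smul_apply, smul_eq_mul]
      have := mul_lt_mul_of_pos_left (hw_op z hz hzx) hκh
      linarith) hout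
  have hNle : κ * h x * w N ≤ h N := by
    have : ((κ * h x) • w - h) N ≤ 0 := by
      by_cases hND : N ∈ Finset.Ioo 0 (x - r)
      · exact hmp N hND
      · exact hout N hN hND
    simpa using this
  have hwN : Real.exp (θ * (N - x)) * (1 - Real.exp (-θ)) ≤ w N := by
    simp only [hw, if_pos hNx]
    have h1 : Real.exp (-θ * x) = Real.exp (θ * (N - x)) * Real.exp (-θ * N) := by
      rw [← Real.exp_add]
      ring_nf
    have h2 : Real.exp (-θ * N) ≤ Real.exp (-θ) := Real.exp_le_exp.2 (by
      have : (1 : ℝ) ≤ N := by exact_mod_cast hN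
      nlinarith)
    rw [h1]
    nlinarith [Real.exp_pos (θ * (N - x))]
  have h3 := (mul_le_mul_of_nonneg_left hwN hκh.le).trans hNle
  have h4 : Real.exp (θ * (N - x)) = (Real.exp (θ * (x - N)))⁻¹ := by
    rw [← Real.exp_neg]
    ring_nf
  rw [h4] at h3
  have hX := Real.exp_pos (θ * (x - N))
  rw [inv_mul_eq_div, div_mul_eq_mul_div, le_div_iff₀ (by positivity)]
  have h5 := mul_le_mul_of_nonneg_left h3 hX.le
  calc h x * (κ * (1 - Real.exp (-θ))) = Real.exp (θ * (x - N)) *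
      (κ * h x * ((Real.exp (θ * (x - N)))⁻¹ * (1 - Real.exp (-θ)))) := by field_simp
    _ ≤ _ := h5

/-- Positive harmonic functions grow at least linearly. -/
lemma exists_mul_le_harmonic (hν : CenteredStep ν θ) {h : ℤ → ℝ} (hpos : ∀ k : ℤ, 0 < k → 0 < h k)
    (hh : ∀ x : ℤ, 0 < x → h x = posOp ν h x) :
    ∃ η : ℝ, 0 < η ∧ ∀ N : ℤ, 0 < N → η * N ≤ h N := by
  have hθ := hν.pos
  obtain ⟨c, M, hc, hM, hmgf, -, hmgf2, hmgf3⟩ := hν.exists_mgf_bounds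
  obtain ⟨r, hr⟩ := hν.exists_nat_mul_exp_lt (2 * M) hc
  obtain ⟨κ, hκ, hharn⟩ := hν.exists_harnack hpos hh r
  obtain ⟨κ', hκ', hharn'⟩ := hν.exists_harnack hpos hh (2 * r + 2)
  obtain ⟨K, hK, hgrow⟩ := hν.exists_harmonic_le_exp hpos hh
  obtain ⟨Q, C, hQ, hQop⟩ := hν.exists_linear_supersolution
  have hh_sum := posSummable_of_harmonic hpos hh
  have hQ_sum : PosSummable ν Q := hν.posSummable_of_bounded (C := C) fun y hy => by
    rw [abs_of_nonneg (hQ y hy).1]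
    exact (hQ y hy).2
  have hC : 0 ≤ C := (hQ 1 one_pos).1.trans (hQ 1 one_pos).2
  set A := K * M / θ + 2 * (K + κ⁻¹) with hA
  have hA0 : 0 < A := by positivity
  have hlarge : ∀ N : ℤ, 2 * r + 2 ≤ N → h 1 ≤ h N * (A / N * (1 + C)) := by
    intro N hrN
    have hN : 0 < N := by omega
    have hN' : (0 : ℝ) < N := by exact_mod_cast hN
    have hrN' : 2 * (r : ℝ) + 2 ≤ N := by exact_mod_cast hrN
    set T : ℤ → ℝ := fun y => if y < N then -(K * Real.exp (θ * (y - N)))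
      else K * Real.exp (θ * (y - N)) with hT
    have hT_sum : PosSummable ν T := by
      refine hν.posSummable_of_le (C := K) fun y hy => ?_
      have hy' : (0 : ℝ) < y := by exact_mod_cast hy
      have h1 : |T y| = K * Real.exp (θ * (y - N)) := by
        simp only [hT]
        split_ifs
        · rw [abs_neg, abs_of_pos (by positivity)]
        · rw [abs_of_pos (by positivity)]
      rw [h1]
      refine mul_le_mul_of_nonneg_left (Real.exp_le_exp.2 ?_) hK.le
      nlinarith [mul_pos hθ hN', mul_pos hθ hy']
    have hT_op : ∀ z : ℤ, 0 < z → z < N - r →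
        posOp ν T z < T z + A / N * Real.exp (-θ * z) := by
      intro z hz hzN
      have hz' : (0 : ℝ) < z := by exact_mod_cast hz
      have hs := (((hν.hasSum_exp (s := θ) (by rw [abs_of_pos hθ]; linarith) N z).mul_left (-K)).add
        ((hν.hasSum_exp (s := 2 * θ) (by rw [abs_of_pos (by positivity)]) N z).mul_left
        (2 * K))).add ((hν.hasSum_exp (s := -(2 * θ))
        (by rw [abs_neg, abs_of_pos (by positivity)]) 0 z).mul_left (K * Real.exp (-θ * N)))
      simp only [sub_zero] at hs
      have hle := hν.posOp_le_of_hasSum hz hT_sum (G := fun y => -K * Real.exp (θ * (y - N)) +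
        2 * K * Real.exp (2 * θ * (y - N)) + K * Real.exp (-θ * N) * Real.exp (-(2 * θ) * y))
        (hs.congr_fun fun y => by ring) (fun y hy => ?_) fun y hy => ?_
      · have hTz : T z = -(K * Real.exp (θ * (z - N))) := by
          simp only [hT]
          rw [if_pos (by omega)]
        have hzN' : (r : ℝ) ≤ N - z := by
          have : (r : ℤ) ≤ N - z := by omega
          exact_mod_cast this
        have h1 := hr _ hzN'
        rw [show -θ * ((N : ℝ) - z) = θ * (z - N) by ring] at h1
        have h2 : Real.exp (2 * θ * (z - N)) = Real.exp (θ * (z - N)) * Real.exp (θ * (z - N)) := by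
          rw [← Real.exp_add]
          ring_nf
        have h3 : Real.exp (-(2 * θ) * z) ≤ Real.exp (-θ * z) :=
          Real.exp_le_exp.2 (by nlinarith)
        have h4 : K * M * Real.exp (-θ * N) ≤ A / N := by
          have e1 := Real.add_one_le_exp (θ * N)
          have e2 : Real.exp (-θ * N) ≤ (θ * N)⁻¹ := by
            rw [neg_mul, Real.exp_neg]
            exact inv_anti₀ (by positivity) (by linarith)
          calc K * M * Real.exp (-θ * N) ≤ K * M * (θ * N)⁻¹ :=
                mul_le_mul_of_nonneg_left e2 (by positivity)
            _ = K * M / θ / N := by field_simp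
            _ ≤ A / N := by
              rw [hA]
              gcongr
              linarith [show 0 < 2 * (K + κ⁻¹) by positivity]
        have hY := Real.exp_pos (-θ * z)
        have h5 : K * Real.exp (-θ * N) * (Real.exp (-(2 * θ) * z) * mgf ν (-(2 * θ))) ≤
            A / N * Real.exp (-θ * z) := by
          calc K * Real.exp (-θ * N) * (Real.exp (-(2 * θ) * z) * mgf ν (-(2 * θ))) ≤
              K * Real.exp (-θ * N) * (Real.exp (-θ * z) * M) := by
                gcongr
                exact hν.mgf_nonneg _
            _ = K * M * Real.exp (-θ * N) * Real.exp (-θ * z) := by ring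
            _ ≤ _ := mul_le_mul_of_nonneg_right h4 hY.le
        rw [h2] at hle
        have hX := Real.exp_pos (θ * (z - N))
        set X := Real.exp (θ * (z - N))
        have h6 : K * X * (1 + c) ≤ K * X * mgf ν θ :=
          mul_le_mul_of_nonneg_left hmgf (by positivity)
        have h7 : 2 * K * (X * X * mgf ν (2 * θ)) ≤ 2 * K * (X * X * M) := by gcongr
        have h8 : K * X * (2 * M * X) < K * X * c := mul_lt_mul_of_pos_left h1 (by positivity)
        rw [hTz]
        linarith
      · have e3 : 0 ≤ K * Real.exp (-θ * N) * Real.exp (-(2 * θ) * y) := by positivity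
        simp only [hT]
        split_ifs with hyN
        · have : 0 ≤ 2 * K * Real.exp (2 * θ * (y - N)) := by positivity
          linarith
        · have hyN' : (N : ℝ) ≤ y := by exact_mod_cast not_lt.1 hyN
          have : Real.exp (θ * (y - N)) ≤ Real.exp (2 * θ * (y - N)) :=
            Real.exp_le_exp.2 (by nlinarith)
          have := mul_le_mul_of_nonneg_left this hK.le
          linarith
      · have hy' : (y : ℝ) ≤ 0 := by exact_mod_cast hy
        have e1 : K * Real.exp (θ * (y - N)) ≤ K * Real.exp (-θ * N) * Real.exp (-(2 * θ) * y) := by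
          rw [mul_assoc, ← Real.exp_add]
          exact mul_le_mul_of_nonneg_left (Real.exp_le_exp.2 (by nlinarith)) hK.le
        have : 0 ≤ 2 * K * Real.exp (2 * θ * (y - N)) := by positivity
        linarith
    set L : ℤ → ℝ := (fun y : ℤ => (y : ℝ)) + Q with hL
    have hL_sum : PosSummable ν L := hν.posSummable_id.add hQ_sum
    have hv_sum : PosSummable ν ((A / N) • L + T) := (hL_sum.smul _).add hT_sum
    have hmp := hν.nonpos_of_lt_posOp (hh_sum.sub (hv_sum.smul (h N))) (Finset.Ioo 0 (N - r))
      (fun z hz => (Finset.mem_Ioo.1 hz).1) (fun z hz => ?_) (fun z hz hzD => ?_) 1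
      (by rw [Finset.mem_Ioo]; omega)
    · have hT1 : T 1 ≤ 0 := by
        simp only [hT]
        rw [if_pos (by omega)]
        exact neg_nonpos.2 (by positivity)
      simp only [Pi.sub_apply, Pi.add_apply, Pi.smul_apply, smul_eq_mul, hL, Int.cast_one] at hmp
      have h1 : A / N * (1 + Q 1) + T 1 ≤ A / N * (1 + C) := by
        have := mul_le_mul_of_nonneg_left (hQ 1 one_pos).2 (show 0 ≤ A / N by positivity)
        linarith
      have := mul_le_mul_of_nonneg_left h1 (hpos N hN).le
      linarith
    · obtain ⟨hz, hzN⟩ := Finset.mem_Ioo.1 hz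
      rw [posOp_sub hh_sum (hv_sum.smul _) hz, posOp_smul, ← hh z hz,
        posOp_add (hL_sum.smul _) hT_sum hz, posOp_smul, hL, posOp_add hν.posSummable_id hQ_sum hz]
      simp only [Pi.sub_apply, Pi.add_apply, Pi.smul_apply, smul_eq_mul]
      have h1 := mul_le_mul_of_nonneg_left (hQop z hz) (show 0 ≤ A / N by positivity)
      have h2 := hT_op z hz hzN
      have h3 : A / N * (posOp ν (fun y => (y : ℝ)) z + posOp ν Q z) + posOp ν T z <
          A / N * (z + Q z) + T z := by linarith
      have := mul_lt_mul_of_pos_left h3 (hpos N hN)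
      linarith
    · have hz2 : N - r ≤ z := by simpa [hz] using hzD
      have hz' : (0 : ℝ) < z := by exact_mod_cast hz
      have hLz : (z : ℝ) ≤ L z := by
        have := (hQ z hz).1
        simp only [hL, Pi.add_apply]
        linarith
      simp only [Pi.sub_apply, Pi.add_apply, Pi.smul_apply, smul_eq_mul, sub_nonpos]
      rcases lt_or_ge z N with hzN | hzN
      · have h1 := hharn z N hz hN (by rw [abs_le]; omega)
        have hzN' : (z : ℝ) ≤ N := by exact_mod_cast hzN.le
        have h2 : -K ≤ T z := by
          simp only [hT, if_pos hzN]
          have : Real.exp (θ * (z - N)) ≤ 1 := Real.exp_le_one_iff.2 (by nlinarith)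
          nlinarith
        have h3 : K + κ⁻¹ ≤ A / N * L z := by
          have hz3 : (N : ℝ) - r ≤ z := by exact_mod_cast hz2
          have hA2 : 2 * (K + κ⁻¹) ≤ A := by
            rw [hA]
            linarith [show 0 ≤ K * M / θ by positivity]
          have hpos' : 0 < K + κ⁻¹ := by positivity
          rw [div_mul_eq_mul_div, le_div_iff₀ hN']
          calc (K + κ⁻¹) * N ≤ 2 * (K + κ⁻¹) * z := by nlinarith
            _ ≤ A * z := by gcongr
            _ ≤ A * L z := by gcongr
        calc h z ≤ h N * κ⁻¹ := by
              rw [← div_eq_mul_inv, le_div_iff₀ hκ]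
              linarith
          _ ≤ _ := mul_le_mul_of_nonneg_left (by linarith) (hpos N hN).le
      · have h1 := hgrow N z hN hzN
        have h2 : T z = K * Real.exp (θ * (z - N)) := by
          simp only [hT]
          rw [if_neg (by omega)]
        have h3 : 0 ≤ A / N * L z := mul_nonneg (by positivity) (hz'.le.trans hLz)
        calc h z ≤ h N * T z := by rw [h2]; linarith
          _ ≤ _ := mul_le_mul_of_nonneg_left (by linarith) (hpos N hN).le
  have h1 := hpos 1 one_pos
  refine ⟨min (h 1 / (A * (1 + C))) (κ' * h 1 / (2 * r + 2)), by positivity, fun N hN => ?_⟩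
  have hN' : (0 : ℝ) < N := by exact_mod_cast hN
  rcases le_or_gt (2 * r + 2 : ℤ) N with hrN | hrN
  · calc _ ≤ h 1 / (A * (1 + C)) * N := by gcongr; exact min_le_left _ _
      _ ≤ h N := by
        rw [div_mul_eq_mul_div, div_le_iff₀ (by positivity)]
        have := mul_le_mul_of_nonneg_right (hlarge N hrN) hN'.le
        calc h 1 * N ≤ _ := this
          _ = _ := by field_simp
  · have hrN' : (N : ℝ) ≤ 2 * r + 2 := by exact_mod_cast hrN.le
    calc _ ≤ κ' * h 1 / (2 * r + 2) * N := by gcongr; exact min_le_right _ _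
      _ ≤ κ' * h 1 := by
        rw [div_mul_eq_mul_div, div_le_iff₀ (by positivity)]
        gcongr
      _ ≤ h N := hharn' 1 N one_pos hN (by rw [abs_le]; push_cast; omega)

lemma _root_.posOp_congr {ν F G : ℤ → ℝ} (h : ∀ y : ℤ, 0 < y → F y = G y) (x : ℤ) :
    posOp ν F x = posOp ν G x := by
  have hFG : (Set.Ioi (0 : ℤ)).indicator F = (Set.Ioi (0 : ℤ)).indicator G :=
    Set.indicator_congr fun y hy => h y hy
  simp only [posOp, hFG]

/-- Tonelli's theorem for iterated sums of nonnegative reals. -/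
lemma _root_.hasSum_tsum_comm_of_nonneg {α β : Type*} {f : α → β → ℝ} {g : α → ℝ} {s : ℝ}
    (h0 : ∀ a b, 0 ≤ f a b) (hf : ∀ a, HasSum (f a) (g a)) (hg : HasSum g s) :
    HasSum (fun b => ∑' a, f a b) s := by
  have hsum : Summable (Function.uncurry f) :=
    (summable_prod_of_nonneg fun p => h0 p.1 p.2).2 ⟨fun a => (hf a).summable, by
      simpa only [Function.uncurry_apply_pair, (hf _).tsum_eq] using hg.summable⟩
  have h1 : HasSum (Function.uncurry f) s := by
    have := hsum.hasSum.prod_fiberwise hf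
    rw [hg.unique this]
    exact hsum.hasSum
  have h2 : HasSum (fun p : β × α => f p.2 p.1) s := (Equiv.prodComm β α).hasSum_iff.2 h1
  exact h2.prod_fiberwise fun b => (h2.summable.prod_factor b).hasSum

lemma _root_.kern_of_nonpos {ν : ℤ → ℝ} (n : ℕ) {x : ℤ} (hx : x ≤ 0) (y : ℤ) :
    kern ν {k : ℤ | 0 < k} n x y = 0 := by
  cases n with
  | zero => simp [kern, not_lt.2 hx]
  | succ n => simp [kern, not_lt.2 hx]

lemma _root_.kern_succ_eq_posOp {ν : ℤ → ℝ} (n : ℕ) {x : ℤ} (hx : 0 < x) (y : ℤ) :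
    kern ν {k : ℤ | 0 < k} (n + 1) x y = posOp ν (fun z => kern ν {k : ℤ | 0 < k} n z y) x := by
  refine tsum_congr fun z => ?_
  rw [if_pos (show x ∈ {k : ℤ | 0 < k} from hx)]
  by_cases hz : 0 < z
  · rw [Set.indicator_of_mem (Set.mem_Ioi.2 hz)]
  · rw [Set.indicator_of_notMem (by simpa using hz), kern_of_nonpos n (not_lt.1 hz)]

lemma kern_nonneg (hν : CenteredStep ν θ) (n : ℕ) (x y : ℤ) :
    0 ≤ kern ν {k : ℤ | 0 < k} n x y := by
  rcases le_or_gt x 0 with hx | hx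
  · rw [kern_of_nonpos n hx]
  induction n generalizing x with
  | zero =>
    simp only [kern]
    split_ifs
    exacts [zero_le_one, le_rfl]
  | succ n ih =>
    rw [kern_succ_eq_posOp n hx]
    exact hν.posOp_nonneg (fun z hz => ih z hz) x

lemma kern_le_one (hν : CenteredStep ν θ) (n : ℕ) (x y : ℤ) :
    kern ν {k : ℤ | 0 < k} n x y ≤ 1 := by
  rcases le_or_gt x 0 with hx | hx
  · rw [kern_of_nonpos n hx]
    exact zero_le_one
  induction n generalizing x with
  | zero =>
    simp only [kern]
    split_ifs
    exacts [le_rfl, zero_le_one]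
  | succ n ih =>
    rw [kern_succ_eq_posOp n hx]
    refine hν.posOp_le_of_hasSum hx (hν.posSummable_of_bounded (C := 1) fun z hz => ?_)
      (hν.hasSum_one x) (fun z hz => ih z hz) fun _ _ => zero_le_one
    rw [abs_of_nonneg (hν.kern_nonneg n z y)]
    exact ih z hz

lemma posSummable_kern (hν : CenteredStep ν θ) (n : ℕ) (y : ℤ) :
    PosSummable ν fun z => kern ν {k : ℤ | 0 < k} n z y :=
  hν.posSummable_of_bounded (C := 1) fun z _ => by
    rw [abs_of_nonneg (hν.kern_nonneg n z y)]
    exact hν.kern_le_one n z y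

lemma posSummable_of_mem_Icc (hν : CenteredStep ν θ) {F : ℤ → ℝ} {C : ℝ}
    (hF : ∀ y : ℤ, 0 < y → F y ∈ Set.Icc 0 C) : PosSummable ν F :=
  hν.posSummable_of_bounded (C := C) fun y hy => by
    rw [abs_of_nonneg (hF y hy).1]
    exact (hF y hy).2

lemma iterate_mem_Icc (hν : CenteredStep ν θ) {F : ℤ → ℝ} {C : ℝ}
    (hF : ∀ y : ℤ, 0 < y → F y ∈ Set.Icc 0 C) (n : ℕ) {x : ℤ} (hx : 0 < x) :
    (posOp ν)^[n] F x ∈ Set.Icc 0 C := by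
  induction n generalizing x with
  | zero => exact hF x hx
  | succ n ih =>
    rw [Function.iterate_succ_apply']
    refine ⟨hν.posOp_nonneg (fun y hy => (ih hy).1) x, ?_⟩
    exact hν.posOp_le_of_hasSum hx (hν.posSummable_of_mem_Icc fun y hy => ih hy)
      (by simpa using (hν.hasSum_one x).mul_right C) (fun y hy => (ih hy).2)
      fun _ _ => (hF x hx).1.trans (hF x hx).2

lemma posSummable_iterate (hν : CenteredStep ν θ) {F : ℤ → ℝ} {C : ℝ}
    (hF : ∀ y : ℤ, 0 < y → F y ∈ Set.Icc 0 C) (n : ℕ) : PosSummable ν ((posOp ν)^[n] F) :=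
  hν.posSummable_of_mem_Icc fun _ hy => hν.iterate_mem_Icc hF n hy

lemma _root_.kern_apply_of_nonpos {ν : ℤ → ℝ} (n : ℕ) {x y : ℤ} (hx : 0 < x) (hy : y ≤ 0) :
    kern ν {k : ℤ | 0 < k} n x y = 0 := by
  induction n generalizing x with
  | zero => simp [kern, show x ≠ y by omega]
  | succ n ih =>
    rw [kern_succ_eq_posOp n hx, posOp_congr (G := fun _ => 0) fun z hz => ih hz]
    simp [posOp]

/-- The kernel of the killed walk represents the iterates of its transition operator. -/
lemma hasSum_kern_mul (hν : CenteredStep ν θ) {F : ℤ → ℝ} {C : ℝ}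
    (hF : ∀ y : ℤ, 0 < y → F y ∈ Set.Icc 0 C) (n : ℕ) {x : ℤ} (hx : 0 < x) :
    HasSum (fun z => kern ν {k : ℤ | 0 < k} n x z * F z) ((posOp ν)^[n] F x) := by
  induction n generalizing x with
  | zero =>
    have h := hasSum_single (f := fun z => kern ν {k : ℤ | 0 < k} 0 x z * F z) x fun z hz => by
      simp [kern, hz.symm]
    simpa [kern, hx] using h
  | succ n ih =>
    rw [Function.iterate_succ_apply']
    have h := hasSum_tsum_comm_of_nonneg
      (f := fun w z => ν (w - x) * (Set.Ioi (0 : ℤ)).indicator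
        (fun w => kern ν {k : ℤ | 0 < k} n w z * F z) w)
      (g := fun w => ν (w - x) * (Set.Ioi (0 : ℤ)).indicator ((posOp ν)^[n] F) w)
      (fun w z => mul_nonneg (hν.nonneg _) (Set.indicator_nonneg (fun w hw => ?_) w))
      (fun w => HasSum.mul_left _ ?_) (hν.posSummable_iterate hF n x hx).hasSum
    · refine h.congr_fun fun z => ?_
      rw [kern_succ_eq_posOp n hx, posOp, ← tsum_mul_right]
      refine tsum_congr fun w => ?_
      by_cases hw : 0 < w <;> simp [hw, mul_assoc]
    · rcases le_or_gt z 0 with hz | hz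
      · rw [kern_apply_of_nonpos n hw hz, zero_mul]
      · exact mul_nonneg (hν.kern_nonneg n w z) (hF z hz).1
    · by_cases hw : 0 < w
      · simpa [hw] using ih hw
      · simp [hw, hasSum_zero]

/-- The mean undershoot `E[(z + X)⁻]` of one step from `z`. -/
noncomputable def undershoot (ν : ℤ → ℝ) (z : ℤ) : ℝ := posOp ν (fun y => (y : ℝ)) z - z

lemma undershoot_nonneg (hν : CenteredStep ν θ) {z : ℤ} (hz : 0 < z) : 0 ≤ undershoot ν z :=
  sub_nonneg.2 (hν.le_posOp_of_hasSum hz hν.posSummable_id (hν.hasSum_id z) (fun _ _ => le_rfl)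
    fun y hy => by exact_mod_cast hy)

lemma tsum_exit_eq (hν : CenteredStep ν θ) {z : ℤ} (hz : 0 < z) :
    ∑' y : ℤ, (if y ∉ {j : ℤ | 0 < j} ∧ y ∈ Set.univ then ν (y - z) else 0) * (y : ℝ) =
      -undershoot ν z := by
  rw [undershoot, neg_sub, ← (hν.hasSum_id z).tsum_eq, posOp,
    ← (hν.hasSum_id z).summable.tsum_sub (hν.posSummable_id z hz)]
  refine tsum_congr fun y => ?_
  by_cases hy : 0 < y <;> simp [hy]

/-- The mean total undershoot at the exit time, so that `fDoney ν k = k + totalUndershoot ν k`. -/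
noncomputable def totalUndershoot (ν : ℤ → ℝ) (x : ℤ) : ℝ :=
  ∑' n : ℕ, (posOp ν)^[n] (undershoot ν) x

lemma exists_totalUndershoot (hν : CenteredStep ν θ) : ∃ C : ℝ,
    (∀ z : ℤ, 0 < z → undershoot ν z ∈ Set.Icc 0 C) ∧ ∀ x : ℤ, 0 < x →
      Summable (fun n : ℕ => (posOp ν)^[n] (undershoot ν) x) ∧
      totalUndershoot ν x ∈ Set.Icc 0 C := by
  obtain ⟨Q, C, hQ, hQop⟩ := hν.exists_linear_supersolution
  have hle : ∀ z : ℤ, 0 < z → undershoot ν z ≤ Q z - posOp ν Q z := fun z hz => by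
    have := hQop z hz
    rw [undershoot]
    linarith [Real.exp_pos (-θ * z)]
  have hmem : ∀ z : ℤ, 0 < z → undershoot ν z ∈ Set.Icc 0 C := fun z hz =>
    ⟨hν.undershoot_nonneg hz, (hle z hz).trans
      (by linarith [hν.posOp_nonneg (fun y hy => (hQ y hy).1) z, (hQ z hz).2])⟩
  have hiter : ∀ (n : ℕ) (z : ℤ), 0 < z → (posOp ν)^[n] (undershoot ν) z ≤
      (posOp ν)^[n] Q z - (posOp ν)^[n + 1] Q z := by
    intro n
    induction n with
    | zero => exact hle
    | succ n ih =>
      intro z hz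
      have hn := hν.posSummable_iterate hQ n
      have hn' := hν.posSummable_iterate hQ (n + 1)
      have e := posOp_sub hn hn' hz
      simp only [Function.iterate_succ_apply' (posOp ν) n (undershoot ν),
        Function.iterate_succ_apply' (posOp ν) (n + 1) Q]
      rw [Function.iterate_succ_apply' (posOp ν) n Q] at e ⊢
      rw [← Function.iterate_succ_apply' (posOp ν) n Q] at e
      have h := hν.posOp_mono (hν.posSummable_iterate hmem n) (hn.sub hn') (fun y hy => ih y hy) hz
      rw [e, Function.iterate_succ_apply' (posOp ν) n Q] at h
      exact h
  refine ⟨C, hmem, fun x hx => ?_⟩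
  have hpart : ∀ n : ℕ, ∑ i ∈ Finset.range n, (posOp ν)^[i] (undershoot ν) x ≤ C := fun n => by
    refine (Finset.sum_le_sum fun i _ => hiter i x hx).trans ?_
    rw [Finset.sum_range_sub' (fun i => (posOp ν)^[i] Q x)]
    have := (hν.iterate_mem_Icc hQ n hx).1
    have := (hQ x hx).2
    simp only [Function.iterate_zero, id]
    linarith
  have hnn : ∀ n : ℕ, 0 ≤ (posOp ν)^[n] (undershoot ν) x := fun n =>
    (hν.iterate_mem_Icc hmem n hx).1
  exact ⟨summable_of_sum_range_le hnn hpart, tsum_nonneg hnn,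
    Real.tsum_le_of_sum_range_le hnn hpart⟩

lemma fDoney_eq (hν : CenteredStep ν θ) {x : ℤ} (hx : 0 < x) :
    fDoney ν x = x + totalUndershoot ν x := by
  obtain ⟨C, hmem, -⟩ := hν.exists_totalUndershoot
  rw [fDoney, exitExp, totalUndershoot, sub_eq_add_neg, ← tsum_neg]
  congr 1
  refine tsum_congr fun n => ?_
  rw [← (hν.hasSum_kern_mul hmem n hx).tsum_eq, ← tsum_neg]
  refine tsum_congr fun z => ?_
  rcases le_or_gt z 0 with hz | hz
  · rw [kern_apply_of_nonpos n hx hz, zero_mul, zero_mul, neg_zero]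
  · rw [← mul_neg, ← neg_eq_iff_eq_neg.2 (hν.tsum_exit_eq hz)]
    congr!

lemma totalUndershoot_eq (hν : CenteredStep ν θ) {x : ℤ} (hx : 0 < x) :
    totalUndershoot ν x = undershoot ν x + posOp ν (totalUndershoot ν) x := by
  obtain ⟨C, hmem, htot⟩ := hν.exists_totalUndershoot
  rw [totalUndershoot, (htot x hx).1.tsum_eq_zero_add]
  congr 1
  have hsum : PosSummable ν (totalUndershoot ν) :=
    hν.posSummable_of_mem_Icc fun y hy => (htot y hy).2
  have h := hasSum_tsum_comm_of_nonneg
    (f := fun (w : ℤ) (n : ℕ) => ν (w - x) * (Set.Ioi (0 : ℤ)).indicator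
      ((posOp ν)^[n] (undershoot ν)) w)
    (fun w n => mul_nonneg (hν.nonneg _) (Set.indicator_nonneg
      (fun w hw => (hν.iterate_mem_Icc hmem n hw).1) w))
    (fun w => HasSum.mul_left _ ?_) (hsum x hx).hasSum
  · rw [posOp, ← h.tsum_eq]
    refine tsum_congr fun n => ?_
    rw [Function.iterate_succ_apply', posOp]
  · by_cases hw : 0 < w
    · simp only [Set.indicator_of_mem (Set.mem_Ioi.2 hw)]
      exact (htot w hw).1.hasSum
    · simp [hw, hasSum_zero]

lemma fDoney_harmonic (hν : CenteredStep ν θ) {x : ℤ} (hx : 0 < x) :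
    fDoney ν x = posOp ν (fDoney ν) x := by
  obtain ⟨C, hmem, htot⟩ := hν.exists_totalUndershoot
  have h := posOp_add hν.posSummable_id
    (hν.posSummable_of_mem_Icc fun y hy => (htot y hy).2) hx
  rw [posOp_congr (G := (fun y : ℤ => (y : ℝ)) + totalUndershoot ν) (fun y hy => hν.fDoney_eq hy),
    h, hν.fDoney_eq hx, hν.totalUndershoot_eq hx, undershoot]
  ring

lemma le_fDoney (hν : CenteredStep ν θ) {x : ℤ} (hx : 0 < x) : (x : ℝ) ≤ fDoney ν x := by
  obtain ⟨C, -, htot⟩ := hν.exists_totalUndershoot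
  rw [hν.fDoney_eq hx]
  linarith [(htot x hx).2.1]

lemma fDoney_pos (hν : CenteredStep ν θ) {x : ℤ} (hx : 0 < x) : 0 < fDoney ν x :=
  lt_of_lt_of_le (by exact_mod_cast hx) (hν.le_fDoney hx)

lemma exists_fDoney_le (hν : CenteredStep ν θ) :
    ∃ C : ℝ, 0 < C ∧ ∀ x : ℤ, 0 < x → fDoney ν x ≤ C * x := by
  obtain ⟨C, hmem, htot⟩ := hν.exists_totalUndershoot
  have hC : 0 ≤ C := (hmem 1 one_pos).1.trans (hmem 1 one_pos).2
  refine ⟨1 + C, by positivity, fun x hx => ?_⟩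
  have hx' : (1 : ℝ) ≤ x := by exact_mod_cast hx
  rw [hν.fDoney_eq hx]
  nlinarith [(htot x hx).2.2]

/-- Every positive harmonic function dominates a positive multiple of `fDoney ν`. -/
lemma exists_mul_fDoney_le (hν : CenteredStep ν θ) {h : ℤ → ℝ} (hpos : ∀ k : ℤ, 0 < k → 0 < h k)
    (hh : ∀ x : ℤ, 0 < x → h x = posOp ν h x) :
    ∃ η : ℝ, 0 < η ∧ ∀ x : ℤ, 0 < x → η * fDoney ν x ≤ h x := by
  obtain ⟨η, hη, H⟩ := hν.exists_mul_le_harmonic hpos hh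
  obtain ⟨C, hC, hf⟩ := hν.exists_fDoney_le
  refine ⟨η / C, by positivity, fun x hx => ?_⟩
  calc η / C * fDoney ν x ≤ η / C * (C * x) := by gcongr; exact hf x hx
    _ = η * x := by field_simp
    _ ≤ h x := H x hx

/-- Uniqueness of positive harmonic functions up to a multiplicative constant. -/
lemma exists_eq_mul_fDoney (hν : CenteredStep ν θ) {h : ℤ → ℝ} (hpos : ∀ k : ℤ, 0 < k → 0 < h k)
    (hh : ∀ x : ℤ, 0 < x → h x = posOp ν h x) :
    ∃ c : ℝ, 0 < c ∧ ∀ x : ℤ, 0 < x → h x = c * fDoney ν x := by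
  have hh_sum := posSummable_of_harmonic hpos hh
  have hf_sum := posSummable_of_harmonic (ν := ν) (h := fDoney ν) (fun k hk => hν.fDoney_pos hk)
    fun x hx => hν.fDoney_harmonic hx
  set S : Set ℝ := {η | ∀ x : ℤ, 0 < x → η * fDoney ν x ≤ h x} with hS
  have hbdd : BddAbove S := ⟨h 1 / fDoney ν 1, fun η hη =>
    (le_div_iff₀ (hν.fDoney_pos one_pos)).2 (hη 1 one_pos)⟩
  obtain ⟨η₀, hη₀, hη₀S⟩ := hν.exists_mul_fDoney_le hpos hh
  have hc0 : 0 < sSup S := hη₀.trans_le (le_csSup hbdd hη₀S)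
  have hcS : sSup S ∈ S := fun x hx => by
    rw [← le_div_iff₀ (hν.fDoney_pos hx)]
    exact csSup_le ⟨η₀, hη₀S⟩ fun η hη => (le_div_iff₀ (hν.fDoney_pos hx)).2 (hη x hx)
  refine ⟨sSup S, hc0, ?_⟩
  by_contra! hne
  obtain ⟨b, hb, hbne⟩ := hne
  set u : ℤ → ℝ := h - sSup S • fDoney ν with hu
  have hu_sum : PosSummable ν u := hh_sum.sub (hf_sum.smul _)
  have hu_nonneg : ∀ x : ℤ, 0 < x → 0 ≤ u x := fun x hx => sub_nonneg.2 (hcS x hx)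
  have hu_harm : ∀ x : ℤ, 0 < x → u x = posOp ν u x := fun x hx => by
    rw [hu, posOp_sub hh_sum (hf_sum.smul _) hx, posOp_smul, ← hh x hx, ← hν.fDoney_harmonic hx]
    rfl
  have hu_pos : ∀ x : ℤ, 0 < x → 0 < u x := fun x hx => by
    refine hν.path_induction (S := fun x => 0 < u x) hb
      (lt_of_le_of_ne (hu_nonneg b hb) (sub_ne_zero.2 hbne).symm) (fun x y hx hy hxy huy => ?_) hx
    rw [hu_harm x hx]
    exact (mul_pos hxy huy).trans_le (hν.mul_le_posOp hu_sum hu_nonneg hx hy)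
  obtain ⟨η, hη, H⟩ := hν.exists_mul_fDoney_le hu_pos hu_harm
  have hmem : sSup S + η ∈ S := fun x hx => by
    have := H x hx
    simp only [hu, Pi.sub_apply, Pi.smul_apply, smul_eq_mul] at this
    linarith
  linarith [le_csSup hbdd hmem]

lemma kern_mul_kern_le (hν : CenteredStep ν θ) (n m : ℕ) {x z : ℤ} (y : ℤ) (hx : 0 < x) :
    kern ν {k : ℤ | 0 < k} n x z * kern ν {k : ℤ | 0 < k} m z y ≤
      kern ν {k : ℤ | 0 < k} (n + m) x y := by
  induction n generalizing x with
  | zero =>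
    rw [zero_add]
    by_cases hxz : x = z
    · subst hxz
      simp [kern, hx]
    · simpa [kern, hxz] using hν.kern_nonneg m x y
  | succ n ih =>
    rw [Nat.add_right_comm, kern_succ_eq_posOp n hx, kern_succ_eq_posOp (n + m) hx, mul_comm,
      ← posOp_smul]
    refine hν.posOp_mono ((hν.posSummable_kern n z).smul _) (hν.posSummable_kern (n + m) y)
      (fun w hw => ?_) hx
    rw [Pi.smul_apply, smul_eq_mul, mul_comm]
    exact ih hw

lemma exists_kern_pos (hν : CenteredStep ν θ) {x y : ℤ} (hx : 0 < x) (hy : 0 < y) :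
    ∃ n : ℕ, 0 < kern ν {k : ℤ | 0 < k} n x y := by
  refine hν.path_induction (S := fun x => ∃ n : ℕ, 0 < kern ν {k : ℤ | 0 < k} n x y) hy
    ⟨0, by simp [kern, hy]⟩ (fun x z hx hz hxz => ?_) hx
  rintro ⟨n, hn⟩
  refine ⟨n + 1, ?_⟩
  rw [kern_succ_eq_posOp n hx]
  exact (mul_pos hxz hn).trans_le
    (hν.mul_le_posOp (hν.posSummable_kern n y) (fun w _ => hν.kern_nonneg n w y) hx hz)

lemma summable_sq (hν : CenteredStep ν θ) : Summable fun k : ℤ => ν k * (k : ℝ) ^ 2 := by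
  have hθ := hν.pos
  refine Summable.of_nonneg_of_le (fun k => mul_nonneg (hν.nonneg k) (sq_nonneg _)) (fun k => ?_)
    (hν.exp.mul_left (2 * θ ^ 2)⁻¹)
  rw [mul_left_comm]
  refine mul_le_mul_of_nonneg_left ?_ (hν.nonneg k)
  rw [inv_mul_eq_div, le_div_iff₀ (by positivity)]
  have h := Real.quadratic_le_exp_of_nonneg (x := 2 * θ * |(k : ℝ)|) (by positivity)
  have h1 : 0 ≤ 2 * θ * |(k : ℝ)| := by positivity
  have h2 : (2 * θ * |(k : ℝ)|) ^ 2 = 4 * θ ^ 2 * (k : ℝ) ^ 2 := by rw [mul_pow, sq_abs]; ring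
  linarith

/-- The parabola `z * (L - z)` on `(0, L)`, extended by zero. -/
noncomputable def parabola (L : ℤ) (z : ℤ) : ℝ := if 0 < z ∧ z < L then (z : ℝ) * (L - z) else 0

lemma parabola_mem_Icc (L z : ℤ) : parabola L z ∈ Set.Icc 0 ((L : ℝ) ^ 2) := by
  rw [parabola]
  split_ifs with h
  · have h1 : (0 : ℝ) < z := by exact_mod_cast h.1
    have h2 : (z : ℝ) < L := by exact_mod_cast h.2
    constructor <;> nlinarith
  · exact ⟨le_rfl, sq_nonneg _⟩

/-- On a long enough interval the transition operator almost preserves the parabola. -/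
lemma exists_parabola_le (hν : CenteredStep ν θ) {δ : ℝ} (hδ : 0 < δ) (L₀ : ℤ) :
    ∃ L : ℤ, L₀ ≤ L ∧ ∀ z : ℤ, 0 < z → (1 - δ) * parabola L z ≤ posOp ν (parabola L) z := by
  set σ : ℝ := ∑' k : ℤ, ν k * (k : ℝ) ^ 2 with hσ
  obtain ⟨N, hN⟩ := exists_int_gt (σ / δ + 1)
  refine ⟨max L₀ N, le_max_left _ _, fun z hz => ?_⟩
  set L := max L₀ N
  have hNL : (N : ℝ) ≤ L := by exact_mod_cast le_max_right L₀ N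
  by_cases hzL : z < L
  · have h1 : (1 : ℝ) ≤ z := by exact_mod_cast hz
    have h2 : (z : ℝ) + 1 ≤ L := by exact_mod_cast hzL
    have hsq : HasSum (fun k : ℤ => ν k * (((k + z : ℤ) : ℝ) * (L - (k + z : ℤ))))
        (z * (L - z) - σ) := by
      have := ((hν.hasSum.mul_right ((z : ℝ) * (L - z))).add
        (hν.mean.mul_right ((L : ℝ) - 2 * z))).sub hν.summable_sq.hasSum
      rw [one_mul, zero_mul, add_zero] at this
      refine this.congr_fun fun k => ?_
      push_cast
      ring
    have hle := hν.le_posOp_of_hasSum (F := parabola L) hz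
      (hν.posSummable_of_mem_Icc fun y _ => parabola_mem_Icc L _)
      (hasSum_shift (F := fun y : ℤ => (y : ℝ) * (L - y)) z hsq) (fun y hy => ?_) fun y hy => ?_
    · refine le_trans ?_ hle
      rw [parabola, if_pos ⟨hz, hzL⟩]
      have h3 : σ ≤ (L - 1) * δ := by
        rw [← div_le_iff₀ hδ]
        linarith
      have h4 : (L : ℝ) - 1 ≤ z * (L - z) := by nlinarith
      nlinarith
    · by_cases hyL : y < L
      · rw [parabola, if_pos ⟨hy, hyL⟩]
      · rw [parabola, if_neg (by tauto)]
        have h3 : (0 : ℝ) < y := by exact_mod_cast hy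
        have h4 : (L : ℝ) ≤ y := by exact_mod_cast not_lt.1 hyL
        nlinarith
    · have h3 : (y : ℝ) ≤ 0 := by exact_mod_cast hy
      nlinarith
  · rw [parabola, if_neg (by tauto), mul_zero]
    exact hν.posOp_nonneg (fun y _ => (parabola_mem_Icc L _).1) z

lemma pow_mul_le_iterate_posOp (hν : CenteredStep ν θ) {w : ℤ → ℝ} {b C : ℝ} (hb : 0 ≤ b)
    (hw : ∀ z : ℤ, 0 < z → w z ∈ Set.Icc 0 C) (h : ∀ z : ℤ, 0 < z → b * w z ≤ posOp ν w z)
    (n : ℕ) {x : ℤ} (hx : 0 < x) : b ^ n * w x ≤ (posOp ν)^[n] w x := by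
  induction n generalizing x with
  | zero => simp
  | succ n ih =>
    rw [Function.iterate_succ_apply']
    calc b ^ (n + 1) * w x = b ^ n * (b * w x) := by ring
      _ ≤ b ^ n * posOp ν w x := by gcongr; exact h x hx
      _ = posOp ν (b ^ n • w) x := (posOp_smul _ _ _).symm
      _ ≤ _ := hν.posOp_mono ((hν.posSummable_of_mem_Icc hw).smul _)
        (hν.posSummable_iterate hw n) (fun y hy => ih hy) hx

/-- The transition probabilities of the killed walk do not decay exponentially. -/
lemma frequently_pow_le_kern (hν : CenteredStep ν θ) {x y : ℤ} (hx : 0 < x) (hy : 0 < y) {a : ℝ}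
    (ha0 : 0 < a) (ha1 : a < 1) : ∃ᶠ n : ℕ in atTop, a ^ n ≤ kern ν {k : ℤ | 0 < k} n x y := by
  set K := kern ν {k : ℤ | 0 < k}
  obtain ⟨L, hL, hop⟩ := hν.exists_parabola_le (δ := (1 - a) / 2) (by linarith) (x + 1)
  set b := 1 - (1 - a) / 2 with hb
  have hwx : 0 < parabola L x := by
    rw [parabola, if_pos ⟨hx, by omega⟩]
    have h1 : (0 : ℝ) < x := by exact_mod_cast hx
    have h2 : (x : ℝ) + 1 ≤ L := by exact_mod_cast hL
    exact mul_pos h1 (by linarith)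
  have hm : ∀ z : ℤ, ∃ m : ℕ, 0 < z → 0 < K m z y := fun z => by
    by_cases hz : 0 < z
    · exact (hν.exists_kern_pos hz hy).imp fun m hm _ => hm
    · exact ⟨0, fun h => absurd h hz⟩
  choose m hm using hm
  intro hcon
  simp only [not_le] at hcon
  set C := ∑ z ∈ Finset.Ioo 0 L, a ^ m z / K (m z) z y * parabola L z
  have hbound : ∀ᶠ n : ℕ in atTop, b ^ n * parabola L x ≤ a ^ n * C := by
    obtain ⟨n₀, hn₀⟩ := eventually_atTop.1 hcon
    filter_upwards [eventually_ge_atTop n₀] with n hn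
    refine (hν.pow_mul_le_iterate_posOp (by linarith) (fun z _ => parabola_mem_Icc L _) hop n
      hx).trans ?_
    have h := hν.hasSum_kern_mul (F := parabola L) (fun z _ => parabola_mem_Icc L _) n hx
    rw [← h.tsum_eq, tsum_eq_sum (s := Finset.Ioo 0 L), Finset.mul_sum]
    · refine Finset.sum_le_sum fun z hz => ?_
      have hz0 : 0 < z := (Finset.mem_Ioo.1 hz).1
      rw [← mul_assoc]
      refine mul_le_mul_of_nonneg_right ?_ (parabola_mem_Icc L _).1
      rw [← mul_div_assoc, ← pow_add, le_div_iff₀ (hm z hz0)]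
      exact (hν.kern_mul_kern_le n (m z) y hx).trans (hn₀ _ (by omega)).le
    · intro z hz
      rw [parabola, if_neg (by simpa using hz), mul_zero]
  have hlim : Tendsto (fun n : ℕ => (a / b) ^ n * C) atTop (𝓝 (0 * C)) :=
    (tendsto_pow_atTop_nhds_zero_of_lt_one (div_nonneg ha0.le (by linarith)) (by
      rw [div_lt_one (by linarith)]; linarith)).mul_const C
  rw [zero_mul] at hlim
  refine hwx.not_ge (ge_of_tendsto hlim ?_)
  filter_upwards [hbound] with n hn
  have hb0 : 0 < b ^ n := pow_pos (by linarith) n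
  rw [div_pow, div_mul_eq_mul_div, le_div_iff₀ hb0, mul_comm]
  exact hn

/-- The spectral radius of the killed walk is one. -/
lemma limsup_kern_rpow (hν : CenteredStep ν θ) {x y : ℤ} (hx : 0 < x) (hy : 0 < y) :
    limsup (fun n : ℕ => kern ν {k : ℤ | 0 < k} n x y ^ ((n : ℝ)⁻¹)) atTop = 1 := by
  have hle : ∀ n : ℕ, kern ν {k : ℤ | 0 < k} n x y ^ ((n : ℝ)⁻¹) ≤ 1 := fun n =>
    Real.rpow_le_one (hν.kern_nonneg n x y) (hν.kern_le_one n x y) (by positivity)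
  have hge : ∀ n : ℕ, 0 ≤ kern ν {k : ℤ | 0 < k} n x y ^ ((n : ℝ)⁻¹) := fun n =>
    Real.rpow_nonneg (hν.kern_nonneg n x y) _
  refine le_antisymm (limsup_le_of_le ?_ (Eventually.of_forall hle)) ?_
  · exact isCoboundedUnder_le_of_le atTop hge
  refine le_of_forall_lt_imp_le_of_dense fun a ha => ?_
  have hbdd : IsBoundedUnder (· ≤ ·) atTop
      fun n : ℕ => kern ν {k : ℤ | 0 < k} n x y ^ ((n : ℝ)⁻¹) :=
    isBoundedUnder_of ⟨1, hle⟩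
  rcases le_or_gt a 0 with ha0 | ha0
  · exact le_limsup_of_frequently_le (Eventually.of_forall fun n => ha0.trans (hge n)).frequently
      hbdd
  refine le_limsup_of_frequently_le (((hν.frequently_pow_le_kern hx hy ha0 ha).and_eventually
    (eventually_gt_atTop 0)).mono fun n hn => ?_) hbdd
  have := Real.rpow_le_rpow (pow_nonneg ha0.le n) hn.1 (z := (n : ℝ)⁻¹) (by positivity)
  rwa [Real.pow_rpow_inv_natCast ha0.le hn.2.ne'] at this

end CenteredStep

theorem statement18 (ν : ℤ → ℝ)
    (hnn : ∀ k, 0 ≤ ν k) (hsum : HasSum ν 1)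
    (hB1 : Irred ν {k : ℤ | 0 < k})
    (hB2 : HasSum (fun k : ℤ => ν k * (k : ℝ)) 0)
    (hB3 : ∃ ε : ℝ, 0 < ε ∧ Summable (fun k : ℤ => ν k * Real.exp (ε * |(k : ℝ)|))) :
    -- `ρ(P₊) = 1`
    (∀ x ∈ {k : ℤ | 0 < k}, ∀ y ∈ {k : ℤ | 0 < k},
      Filter.limsup (fun n : ℕ => (kern ν {k : ℤ | 0 < k} n x y) ^ ((n : ℝ)⁻¹)) atTop = 1) ∧
    -- every positive multiple of `f` is a positive harmonic function of `P₊`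
    (∀ c : ℝ, 0 < c →
      (∀ k : ℤ, 0 < k → 0 < c * fDoney ν k) ∧
      HarmOn ν {k : ℤ | 0 < k} (fun k => c * fDoney ν k)) ∧
    -- and conversely every positive harmonic function of `P₊` is such a multiple
    (∀ g : ℤ → ℝ, (∀ k : ℤ, 0 < k → 0 < g k) → HarmOn ν {k : ℤ | 0 < k} g →
      ∃ c : ℝ, 0 < c ∧ ∀ k : ℤ, 0 < k → g k = c * fDoney ν k) := by
  obtain ⟨ε, hε, hexp⟩ := hB3
  have hν : CenteredStep ν (ε / 2) :=
    ⟨hnn, hsum, hB1, hB2, by linarith, by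
      simpa only [mul_div_cancel₀ ε (two_ne_zero' ℝ)] using hexp⟩
  refine ⟨fun x hx y hy => hν.limsup_kern_rpow hx hy, fun c hc => ⟨fun k hk =>
    mul_pos hc (hν.fDoney_pos hk), harmOn_iff.2 fun x hx => ?_⟩, fun g hg hharm =>
    hν.exists_eq_mul_fDoney hg (harmOn_iff.1 hharm)⟩
  have h := posOp_smul (ν := ν) c (fDoney ν) x
  rw [← hν.fDoney_harmonic hx] at h
  exact h.symm
end
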